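/- Fix ρ ∈ (0,1) with ρ ≠ 1/2 and ρ₁ with max{ρ, 1−ρ} < ρ₁ < 1, and let g be the minimization allocation function g(Λ,X) = ρ₁·1(D<0) + (1−ρ₁)·1(D>0) + ρ·1(D=0) with D(Λ,X) = 2⟨X,Λ⟩ + (1−2ρ)‖X‖². Let Γ be a Borel probability measure on ℝ^d that is sub-exponential, whose mixture Γ_ρ is spread out, and which is not bounded: Γ({x : ‖x‖ > M}) > 0 for every M > 0. Let π be the unique invariant probability measure of the kernel P_g. Then there exists a bounded measurable function f: ℝ^d → ℝ (one may take f the indicator of {x : ‖x‖ ≥ M_L} for suitable M_L > 0) such that ∫ ( ∫ g(Λ, x) dπ(Λ) − ρ )·f(x) dΓ(x) ≠ 0; consequently, with h(Λ) := ∫ (g(Λ,X) − ρ)·f(X) dΓ(X), the average shift (1/n)·Σ_{i=1}^n (P_g^{i−1} h)(Λ) converges to the nonzero limit ∫ h dπ and hence does not converge to zero. -/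

import Mathlib

open MeasureTheory ProbabilityTheory Filter Set
open scoped ENNReal RealInnerProductSpace

noncomputable section

/-- `ℝ^d` with the Euclidean norm. -/
abbrev Ed (d : ℕ) : Type := EuclideanSpace ℝ (Fin d)

/-- Action of the CAR transition kernel `P_g` on a function `h`:
`(P_g h)(Λ) = ∫ [ g(Λ,X)·h(Λ + (1−ρ)X) + (1−g(Λ,X))·h(Λ − ρX) ] dΓ(X)`. -/
def kernelOp (d : ℕ) (ρ : ℝ) (Γ : Measure (Ed d)) (g : Ed d → Ed d → ℝ)
    (h : Ed d → ℝ) (Λ : Ed d) : ℝ :=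
  ∫ X, g Λ X * h (Λ + (1 - ρ) • X) + (1 - g Λ X) * h (Λ - ρ • X) ∂Γ

/-- `W_Γ`: the linear span of the topological support of `Γ` (the set of points all of
whose open neighbourhoods have positive measure). -/
def suppSpan (d : ℕ) (Γ : Measure (Ed d)) : Submodule ℝ (Ed d) :=
  Submodule.span ℝ {x : Ed d | ∀ U : Set (Ed d), IsOpen U → x ∈ U → 0 < Γ U}

/-- The `(M,Δ)`-negative feedback condition for an allocation function `g`. -/
def NegFeedback (d : ℕ) (ρ M Δ : ℝ) (Γ : Measure (Ed d)) (g : Ed d → Ed d → ℝ) : Prop :=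
  ∀ Λ : Ed d, Λ ∈ suppSpan d Γ → M ≤ ‖Λ‖ →
    (∫ X, (g Λ X - ρ) * (⟪X, Λ⟫ / ‖Λ‖) ∂Γ) ≤ -Δ

/-- `Γ` is sub-exponential: `∫ exp(λ‖X‖) dΓ(X) < ∞` for some `λ > 0`. -/
def SubExp (d : ℕ) (Γ : Measure (Ed d)) : Prop :=
  ∃ l : ℝ, 0 < l ∧ Integrable (fun x => Real.exp (l * ‖x‖)) Γ

/-- `k`-fold convolution power of a measure (`convPow μ 0` is the Dirac mass at `0`). -/
def convPow (d : ℕ) (μ : Measure (Ed d)) : ℕ → Measure (Ed d)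
  | 0 => Measure.dirac 0
  | n + 1 => ((convPow d μ n).prod μ).map (fun p => p.1 + p.2)

/-- A measure is spread out if some convolution power dominates `f·Leb` for a nonnegative
measurable `f` with `∫ f dLeb > 0`. -/
def SpreadOut (d : ℕ) (μ : Measure (Ed d)) : Prop :=
  ∃ k : ℕ, 0 < k ∧ ∃ f : Ed d → ℝ, Measurable f ∧ (∀ x, 0 ≤ f x) ∧
    (0 < ∫ x, f x) ∧
    ∀ A : Set (Ed d), MeasurableSet A →
      ENNReal.ofReal (∫ x in A, f x) ≤ convPow d μ k A

/-- `Γ_ρ`: the mixture `ρ·((1−ρ)·Γ) + (1−ρ)·((−ρ)·Γ)` of the pushforwards of `Γ` under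
scalar multiplication by `1−ρ` and by `−ρ`. -/
def mixMeasure (d : ℕ) (ρ : ℝ) (Γ : Measure (Ed d)) : Measure (Ed d) :=
  ENNReal.ofReal ρ • Γ.map (fun x => (1 - ρ) • x) +
    ENNReal.ofReal (1 - ρ) • Γ.map (fun x => (-ρ) • x)

/-- `π` is an invariant probability measure for the kernel `P_g`:
`π(A) = ∫ P_g(Λ, A) dπ(Λ)` for every Borel set `A`. -/
def IsInvariantMeasure (d : ℕ) (ρ : ℝ) (Γ : Measure (Ed d)) (g : Ed d → Ed d → ℝ)
    (π : Measure (Ed d)) : Prop :=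
  ∀ A : Set (Ed d), MeasurableSet A →
    (π A).toReal = ∫ Λ, kernelOp d ρ Γ g (A.indicator fun _ => (1 : ℝ)) Λ ∂π

/-- The allocation function of the minimization procedure with biased coin probability `ρ₁`. -/
def gMin (d : ℕ) (ρ ρ₁ : ℝ) (Λ X : Ed d) : ℝ :=
  if 2 * ⟪X, Λ⟫ + (1 - 2 * ρ) * ‖X‖ ^ 2 < 0 then ρ₁
  else if 0 < 2 * ⟪X, Λ⟫ + (1 - 2 * ρ) * ‖X‖ ^ 2 then 1 - ρ₁
  else ρ

/-! ### Setwise limits of probability measures along an ultrafilter -/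

section UltrafilterLimit

variable {E : Type*} [MeasurableSpace E]

/-- The limit of `∫⁻ φ dμ n` along the ultrafilter `U`. -/
def ultraLim (U : Ultrafilter ℕ) (μ : ℕ → Measure E) (φ : E → ℝ≥0∞) : ℝ≥0∞ :=
  (U.map fun n => ∫⁻ x, φ x ∂μ n).lim

variable (U : Ultrafilter ℕ) (μ : ℕ → Measure E)

theorem tendsto_ultraLim (φ : E → ℝ≥0∞) :
    Tendsto (fun n => ∫⁻ x, φ x ∂μ n) U (nhds (ultraLim U μ φ)) :=
  (U.map fun n => ∫⁻ x, φ x ∂μ n).le_nhds_lim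

variable {U μ}

theorem ultraLim_eq {φ : E → ℝ≥0∞} {a : ℝ≥0∞}
    (h : Tendsto (fun n => ∫⁻ x, φ x ∂μ n) U (nhds a)) : ultraLim U μ φ = a :=
  tendsto_nhds_unique (tendsto_ultraLim U μ φ) h

theorem ultraLim_mono {φ ψ : E → ℝ≥0∞} (h : ∀ x, φ x ≤ ψ x) :
    ultraLim U μ φ ≤ ultraLim U μ ψ :=
  le_of_tendsto_of_tendsto' (tendsto_ultraLim U μ φ) (tendsto_ultraLim U μ ψ)
    fun _ => lintegral_mono h

theorem ultraLim_add {φ ψ : E → ℝ≥0∞} (hφ : Measurable φ) :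
    ultraLim U μ (fun x => φ x + ψ x) = ultraLim U μ φ + ultraLim U μ ψ := by
  refine ultraLim_eq ?_
  simpa only [lintegral_add_left hφ] using
    (tendsto_ultraLim U μ φ).add (tendsto_ultraLim U μ ψ)

theorem ultraLim_const [∀ n, IsProbabilityMeasure (μ n)] (c : ℝ≥0∞) :
    ultraLim U μ (fun _ => c) = c :=
  ultraLim_eq (by simp)

theorem ultraLim_sum {ι : Type*} (s : Finset ι) {φ : ι → E → ℝ≥0∞} (hφ : ∀ i, Measurable (φ i)) :
    ultraLim U μ (fun x => ∑ i ∈ s, φ i x) = ∑ i ∈ s, ultraLim U μ (φ i) := by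
  refine ultraLim_eq ?_
  simpa only [lintegral_finsetSum s fun i _ => hφ i] using
    tendsto_finsetSum s fun i _ => tendsto_ultraLim U μ (φ i)

theorem mul_ultraLim_le {φ : E → ℝ≥0∞} (hφ : Measurable φ) (c : ℝ≥0∞) :
    c * ultraLim U μ φ ≤ ultraLim U μ (fun x => c * φ x) := by
  by_cases h : ultraLim U μ φ = 0
  · simp [h]
  · refine (ultraLim_eq ?_).ge
    simpa only [lintegral_const_mul c hφ] using
      ENNReal.Tendsto.const_mul (tendsto_ultraLim U μ φ) (Or.inl h)

/-- A sequence of measurable functions with values in `[0, b]` decreasing to `0`. -/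
structure DecreasesToZero (b : ℝ≥0∞) (φ : ℕ → E → ℝ≥0∞) : Prop where
  measurable : ∀ j, Measurable (φ j)
  antitone : Antitone φ
  le : ∀ j x, φ j x ≤ b
  iInf_eq : ∀ x, ⨅ j, φ j x = 0

theorem iInf_lintegral_eq_zero {b : ℝ≥0∞} (hb : b ≠ ∞) {φ : ℕ → E → ℝ≥0∞}
    (hφ : DecreasesToZero b φ) (m : Measure E) [IsFiniteMeasure m] :
    ⨅ j, ∫⁻ x, φ j x ∂m = 0 := by
  rw [← lintegral_iInf hφ.measurable hφ.antitone]
  · simp [hφ.iInf_eq]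
  · refine ((lintegral_mono (hφ.le 0)).trans_lt ?_).ne
    rw [lintegral_const]
    exact ENNReal.mul_lt_top hb.lt_top (measure_lt_top m _)

theorem decreasesToZero_indicator {s : ℕ → Set E} (hs : ∀ j, MeasurableSet (s j))
    (hanti : Antitone s) (hempty : ⋂ j, s j = ∅) :
    DecreasesToZero 1 fun j => (s j).indicator fun _ => (1 : ℝ≥0∞) where
  measurable j := measurable_const.indicator (hs j)
  antitone i j hij x := indicator_le_indicator_of_subset (hanti hij) (fun _ => zero_le) x
  le j x := indicator_le_self' (fun _ _ => zero_le) x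
  iInf_eq x := by
    have hx : x ∉ ⋂ j, s j := by simp [hempty]
    obtain ⟨j, hj⟩ := by simpa using hx
    refine le_antisymm ((iInf_le _ j).trans ?_) zero_le
    simp [hj]

/-- If the ultrafilter limit functional is continuous along decreasing sequences, then it is the
integral against a probability measure. -/
theorem exists_measure_eq_ultraLim [∀ n, IsProbabilityMeasure (μ n)]
    (H : ∀ φ : ℕ → E → ℝ≥0∞, DecreasesToZero 1 φ → ⨅ j, ultraLim U μ (φ j) = 0) :
    ∃ ν : Measure E, IsProbabilityMeasure ν ∧
      ∀ φ : E → ℝ≥0∞, Measurable φ → ∀ b : ℝ≥0∞, b ≠ ∞ → (∀ x, φ x ≤ b) →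
        ultraLim U μ φ = ∫⁻ x, φ x ∂ν := by
  have hun : ∀ f : ℕ → Set E, (∀ i, MeasurableSet (f i)) → Pairwise (Function.onFun Disjoint f) →
      ultraLim U μ ((⋃ i, f i).indicator fun _ => (1 : ℝ≥0∞)) =
        ∑' i, ultraLim U μ ((f i).indicator fun _ => (1 : ℝ≥0∞)) := by
    intro f hf hd
    have hm : ∀ i, Measurable ((f i).indicator fun _ => (1 : ℝ≥0∞)) := fun i =>
      measurable_const.indicator (hf i)
    have hpt : ∀ x, (⋃ i, f i).indicator (fun _ => (1 : ℝ≥0∞)) x =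
        ∑' i, (f i).indicator (fun _ => (1 : ℝ≥0∞)) x := by
      intro x
      have := measure_iUnion (μ := Measure.dirac x) hd hf
      rw [Measure.dirac_apply' _ (MeasurableSet.iUnion hf)] at this
      simp only [Measure.dirac_apply' _ (hf _)] at this
      exact this
    apply le_antisymm
    · set tail : ℕ → Set E := fun n => ⋃ i, f (i + n) with htail
      have htm : ∀ n, MeasurableSet (tail n) := fun n => MeasurableSet.iUnion fun i => hf _
      have hdz : DecreasesToZero 1 fun n => (tail n).indicator fun _ => (1 : ℝ≥0∞) := by
        refine decreasesToZero_indicator htm ?_ ?_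
        · intro a b hab x hx
          obtain ⟨i, hi⟩ := mem_iUnion.1 hx
          refine mem_iUnion.2 ⟨i + (b - a), ?_⟩
          rwa [add_assoc, Nat.sub_add_cancel hab]
        · rw [eq_empty_iff_forall_notMem]
          intro x hx
          rw [mem_iInter] at hx
          obtain ⟨i, hi⟩ := mem_iUnion.1 (hx 0)
          obtain ⟨j, hj⟩ := mem_iUnion.1 (hx (i + 1))
          exact (hd (show i + 0 ≠ j + (i + 1) by omega)).le_bot ⟨hi, hj⟩
      have hle : ∀ n, ultraLim U μ ((⋃ i, f i).indicator fun _ => (1 : ℝ≥0∞)) ≤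
          (∑' i, ultraLim U μ ((f i).indicator fun _ => (1 : ℝ≥0∞))) +
            ultraLim U μ ((tail n).indicator fun _ => (1 : ℝ≥0∞)) := by
        intro n
        calc _ ≤ ultraLim U μ (fun x => (∑ i ∈ Finset.range n,
                (f i).indicator (fun _ => (1 : ℝ≥0∞)) x) +
                  (tail n).indicator (fun _ => (1 : ℝ≥0∞)) x) := by
              refine ultraLim_mono fun y => ?_
              by_cases hy : y ∈ ⋃ i, f i
              swap
              · simp [hy]
              obtain ⟨i, hi⟩ := mem_iUnion.1 hy
              rcases lt_or_ge i n with h | h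
              · refine le_trans ?_ le_self_add
                refine le_trans ?_ (Finset.single_le_sum (fun _ _ => zero_le)
                  (Finset.mem_range.2 h))
                simp only [indicator_of_mem hy, indicator_of_mem hi, le_refl]
              · refine le_trans ?_ le_add_self
                have : y ∈ tail n := mem_iUnion.2 ⟨i - n, by rwa [Nat.sub_add_cancel h]⟩
                simp only [indicator_of_mem hy, indicator_of_mem this, le_refl]
          _ = (∑ i ∈ Finset.range n, ultraLim U μ ((f i).indicator fun _ => (1 : ℝ≥0∞))) +
                ultraLim U μ ((tail n).indicator fun _ => (1 : ℝ≥0∞)) := by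
              rw [ultraLim_add (Finset.measurable_fun_sum _ fun i _ => hm i), ultraLim_sum _ hm]
          _ ≤ _ := by gcongr; exact ENNReal.sum_le_tsum _
      have := le_iInf hle
      rwa [← ENNReal.add_iInf, H _ hdz, add_zero] at this
    · rw [ENNReal.tsum_eq_iSup_nat]
      refine iSup_le fun n => ?_
      rw [← ultraLim_sum _ hm]
      refine ultraLim_mono fun x => ?_
      rw [hpt]
      exact ENNReal.sum_le_tsum _
  let ν : Measure E := Measure.ofMeasurable
    (fun s _ => ultraLim U μ (s.indicator fun _ => (1 : ℝ≥0∞)))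
    (by simpa using ultraLim_const (U := U) (μ := μ) 0) (fun f hf hd => hun f hf hd)
  have hν : ∀ s, MeasurableSet s → ν s = ultraLim U μ (s.indicator fun _ => (1 : ℝ≥0∞)) :=
    fun s hs => Measure.ofMeasurable_apply s hs
  have hprob : IsProbabilityMeasure ν := ⟨by
    rw [hν _ MeasurableSet.univ]
    simpa using ultraLim_const (U := U) (μ := μ) 1⟩
  have hge : ∀ φ : E → ℝ≥0∞, Measurable φ → ∫⁻ x, φ x ∂ν ≤ ultraLim U μ φ := by
    intro φ hφ
    refine Measurable.ennreal_induction
      (motive := fun φ => ∫⁻ x, φ x ∂ν ≤ ultraLim U μ φ) ?_ ?_ ?_ hφ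
    · intro c s hs
      rw [lintegral_indicator_const hs, hν s hs]
      refine (mul_ultraLim_le (measurable_const.indicator hs) c).trans (ultraLim_mono fun x => ?_)
      by_cases hx : x ∈ s <;> simp [hx]
    · intro f g _ hf _ ihf ihg
      simp only [Pi.add_apply]
      rw [lintegral_add_left hf]
      exact (add_le_add ihf ihg).trans (ultraLim_add hf).ge
    · intro f hf hmono ih
      rw [lintegral_iSup hf hmono]
      exact iSup_le fun n => (ih n).trans (ultraLim_mono fun x => le_iSup (fun n => f n x) n)
  refine ⟨ν, hprob, fun φ hφ b hb hle => le_antisymm ?_ (hge φ hφ)⟩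
  have h1 : ultraLim U μ φ + ultraLim U μ (fun x => b - φ x) = b := by
    rw [← ultraLim_add hφ]
    simp only [add_tsub_cancel_of_le (hle _)]
    exact ultraLim_const b
  have h2 : ∫⁻ x, φ x ∂ν + ∫⁻ x, b - φ x ∂ν = b := by
    rw [← lintegral_add_left hφ]
    simp [add_tsub_cancel_of_le (hle _)]
  have h3 := hge (fun x => b - φ x) (measurable_const.sub hφ)
  have h4 : ∫⁻ x, b - φ x ∂ν ≠ ∞ := ne_top_of_le_ne_top hb (le_add_self.trans_eq h2)
  refine (ENNReal.add_le_add_iff_right h4).1 ?_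
  calc _ ≤ ultraLim U μ φ + ultraLim U μ (fun x => b - φ x) := by gcongr
    _ = _ := h1.trans h2.symm

/-- If the limit functional is invariant under a Markov transition `K` which dominates a transition
`T` of constant mass `t > 0` along which decreasing sequences are regularised, then the limit
functional is continuous along decreasing sequences. -/
theorem iInf_ultraLim_eq_zero [∀ n, IsProbabilityMeasure (μ n)] {K T : E → Measure E} {t : ℝ≥0∞}
    (hK : Measurable K) (hT : Measurable T) (hKp : ∀ x, IsProbabilityMeasure (K x))
    (hTK : ∀ x, T x ≤ K x) (hTt : ∀ x, T x univ = t) (ht : t ≠ 0)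
    (hinv : ∀ φ : E → ℝ≥0∞, Measurable φ → (∀ x, φ x ≤ 1) →
      ultraLim U μ (fun x => ∫⁻ y, φ y ∂K x) = ultraLim U μ φ)
    (hreg : ∀ φ : ℕ → E → ℝ≥0∞, DecreasesToZero 1 φ →
      ⨅ j, ultraLim U μ (fun x => ∫⁻ y, φ j y ∂T x) = 0)
    (φ : ℕ → E → ℝ≥0∞) (hφ : DecreasesToZero 1 φ) : ⨅ j, ultraLim U μ (φ j) = 0 := by
  have hTfin : ∀ x, IsFiniteMeasure (T x) := fun x =>
    ⟨(hTK x univ).trans_lt (measure_lt_top (K x) _)⟩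
  let Q : E → Measure E := fun x => K x - T x
  have hQK : ∀ x, Q x + T x = K x := fun x => Measure.sub_add_cancel_of_le (hTK x)
  have hQm : ∀ x, Q x univ = 1 - t := fun x => by
    rw [Measure.sub_apply MeasurableSet.univ (hTK x), hTt, measure_univ]
  have hQfin : ∀ x, IsFiniteMeasure (Q x) := fun x => ⟨by
    rw [hQm]; exact tsub_le_self.trans_lt ENNReal.one_lt_top⟩
  have hQmeas : Measurable Q := by
    refine Measure.measurable_of_measurable_coe _ fun s hs => ?_
    simp only [Q, Measure.sub_apply hs (hTK _)]
    exact ((Measure.measurable_coe hs).comp hK).sub ((Measure.measurable_coe hs).comp hT)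
  have hβ : 1 - t < 1 := ENNReal.sub_lt_self ENNReal.one_ne_top one_ne_zero ht
  have key : ∀ (J : ℕ) (b : ℝ≥0∞), b ≤ 1 → ∀ φ : ℕ → E → ℝ≥0∞, DecreasesToZero b φ →
      ⨅ j, ultraLim U μ (φ j) ≤ (1 - t) ^ J * b := by
    intro J
    induction J with
    | zero =>
      intro b _ φ hφ
      refine (iInf_le _ 0).trans ((ultraLim_mono (hφ.le 0)).trans ?_)
      simp [ultraLim_const]
    | succ J ih =>
      intro b hb φ hφ
      have hb' : b ≠ ∞ := ne_top_of_le_ne_top ENNReal.one_ne_top hb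
      have hφ1 : DecreasesToZero 1 φ := ⟨hφ.measurable, hφ.antitone,
        fun j x => (hφ.le j x).trans hb, hφ.iInf_eq⟩
      have hQ : DecreasesToZero ((1 - t) * b) fun j x => ∫⁻ y, φ j y ∂Q x := by
        refine ⟨fun j => (Measure.measurable_lintegral (hφ.measurable j)).comp hQmeas,
          fun i j hij x => lintegral_mono (hφ.antitone hij), fun j x => ?_,
          fun x => iInf_lintegral_eq_zero hb' hφ (Q x)⟩
        refine (lintegral_mono (hφ.le j)).trans ?_
        rw [lintegral_const, hQm, mul_comm]
      have hsplit : ∀ j, ultraLim U μ (φ j) = ultraLim U μ (fun x => ∫⁻ y, φ j y ∂Q x) +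
          ultraLim U μ (fun x => ∫⁻ y, φ j y ∂T x) := by
        intro j
        rw [← hinv _ (hφ.measurable j) (hφ1.le j), ← ultraLim_add (hQ.measurable j)]
        simp only [← lintegral_add_measure, hQK]
      simp only [hsplit]
      have hmono : ∀ M : E → Measure E, Antitone fun j => ultraLim U μ fun x => ∫⁻ y, φ j y ∂M x :=
        fun M i j hij => ultraLim_mono fun x => lintegral_mono (hφ.antitone hij)
      rw [← ENNReal.iInf_add_iInf fun i j => ⟨max i j, add_le_add
        (hmono Q (le_max_left i j)) (hmono T (le_max_right i j))⟩,
        hreg φ hφ1, add_zero, pow_succ, mul_assoc]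
      exact ih _ (mul_le_one' hβ.le hb) _ hQ
  refine le_antisymm (ge_of_tendsto' (ENNReal.tendsto_pow_atTop_nhds_zero_of_lt_one hβ)
    fun J => ?_) zero_le
  simpa using key J 1 le_rfl φ hφ

end UltrafilterLimit

/-! ### The transition kernel as a family of measures -/

section StepMeasure

variable {d : ℕ} {ρ : ℝ} {Γ : Measure (Ed d)} {g : Ed d → Ed d → ℝ}

/-- The one-step transition probability of the chain started at `Λ`. -/
def stepMeasure (d : ℕ) (ρ : ℝ) (Γ : Measure (Ed d)) (g : Ed d → Ed d → ℝ) (Λ : Ed d) :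
    Measure (Ed d) :=
  (Γ.withDensity fun X => ENNReal.ofReal (g Λ X)).map (fun X => Λ + (1 - ρ) • X) +
    (Γ.withDensity fun X => ENNReal.ofReal (1 - g Λ X)).map (fun X => Λ - ρ • X)

theorem lintegral_stepMeasure (hg : Measurable (Function.uncurry g)) {φ : Ed d → ℝ≥0∞}
    (hφ : Measurable φ) (Λ : Ed d) :
    ∫⁻ y, φ y ∂stepMeasure d ρ Γ g Λ =
      ∫⁻ X, (ENNReal.ofReal (g Λ X) * φ (Λ + (1 - ρ) • X) +
        ENNReal.ofReal (1 - g Λ X) * φ (Λ - ρ • X)) ∂Γ := by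
  have hgΛ : Measurable (g Λ) := hg.of_uncurry_left
  have h1 : Measurable fun X => ENNReal.ofReal (g Λ X) := by fun_prop
  have h2 : Measurable fun X => ENNReal.ofReal (1 - g Λ X) := by fun_prop
  have h3 : Measurable fun X : Ed d => Λ + (1 - ρ) • X := by fun_prop
  have h4 : Measurable fun X : Ed d => Λ - ρ • X := by fun_prop
  rw [stepMeasure, lintegral_add_measure, lintegral_map hφ h3, lintegral_map hφ h4,
    lintegral_withDensity_eq_lintegral_mul _ h1
      (show Measurable fun X => φ (Λ + (1 - ρ) • X) from hφ.comp h3),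
    lintegral_withDensity_eq_lintegral_mul _ h2
      (show Measurable fun X => φ (Λ - ρ • X) from hφ.comp h4)]
  exact (lintegral_add_left (h1.mul (hφ.comp h3)) _).symm

theorem measurable_stepMeasure [SFinite Γ] (hg : Measurable (Function.uncurry g)) :
    Measurable (stepMeasure d ρ Γ g) := by
  refine Measure.measurable_of_measurable_coe _ fun s hs => ?_
  have : ∀ Λ, stepMeasure d ρ Γ g Λ s = ∫⁻ X,
      (ENNReal.ofReal (g Λ X) * s.indicator 1 (Λ + (1 - ρ) • X) +
        ENNReal.ofReal (1 - g Λ X) * s.indicator 1 (Λ - ρ • X)) ∂Γ := fun Λ => by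
    rw [← lintegral_stepMeasure hg (measurable_one.indicator hs), lintegral_indicator_one hs]
  simp only [this]
  have hi : Measurable (s.indicator (1 : Ed d → ℝ≥0∞)) := measurable_one.indicator hs
  refine Measurable.lintegral_prod_right
    (f := fun Λ X => ENNReal.ofReal (g Λ X) * s.indicator 1 (Λ + (1 - ρ) • X) +
        ENNReal.ofReal (1 - g Λ X) * s.indicator 1 (Λ - ρ • X)) ?_
  have hg' : Measurable fun p : Ed d × Ed d => g p.1 p.2 := hg
  exact (hg'.ennreal_ofReal.mul (hi.comp (by fun_prop : Measurable fun p : Ed d × Ed d =>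
    p.1 + (1 - ρ) • p.2))).add ((hg'.const_sub 1).ennreal_ofReal.mul
      (hi.comp (by fun_prop : Measurable fun p : Ed d × Ed d => p.1 - ρ • p.2)))

theorem isProbabilityMeasure_stepMeasure [IsProbabilityMeasure Γ]
    (hg : Measurable (Function.uncurry g)) (hg01 : ∀ Λ X, g Λ X ∈ Icc (0 : ℝ) 1) (Λ : Ed d) :
    IsProbabilityMeasure (stepMeasure d ρ Γ g Λ) := by
  refine ⟨?_⟩
  rw [← lintegral_one, lintegral_stepMeasure hg measurable_const]
  have : ∀ X, ENNReal.ofReal (g Λ X) * 1 + ENNReal.ofReal (1 - g Λ X) * 1 = 1 := fun X => by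
    rw [mul_one, mul_one, ← ENNReal.ofReal_add (hg01 Λ X).1 (sub_nonneg.2 (hg01 Λ X).2)]
    simp
  simp only [this, lintegral_one, measure_univ]

theorem kernelOp_eq_integral_stepMeasure [IsProbabilityMeasure Γ]
    (hg : Measurable (Function.uncurry g)) (hg01 : ∀ Λ X, g Λ X ∈ Icc (0 : ℝ) 1)
    {h : Ed d → ℝ} (hh : Measurable h) {C : ℝ} (hC : ∀ x, |h x| ≤ C) (Λ : Ed d) :
    kernelOp d ρ Γ g h Λ = ∫ y, h y ∂stepMeasure d ρ Γ g Λ := by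
  have hgΛ : Measurable (g Λ) := hg.of_uncurry_left
  have h1 : Measurable fun X => ENNReal.ofReal (g Λ X) := by fun_prop
  have h2 : Measurable fun X => ENNReal.ofReal (1 - g Λ X) := by fun_prop
  have h3 : Measurable fun X : Ed d => Λ + (1 - ρ) • X := by fun_prop
  have h4 : Measurable fun X : Ed d => Λ - ρ • X := by fun_prop
  have hp := isProbabilityMeasure_stepMeasure (ρ := ρ) hg hg01 Λ (Γ := Γ)
  have hint : Integrable h (stepMeasure d ρ Γ g Λ) :=
    Integrable.of_bound hh.aestronglyMeasurable C (ae_of_all _ hC)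
  have hb : ∀ w : Ed d → ℝ, Measurable w → (∀ X, w X ∈ Icc (0 : ℝ) 1) → ∀ T : Ed d → Ed d,
      Measurable T → Integrable (fun X => w X * h (T X)) Γ := fun w hw hw1 T hT =>
    Integrable.of_bound (hw.mul (hh.comp hT)).aestronglyMeasurable C (ae_of_all _ fun X => by
      rw [Real.norm_eq_abs, abs_mul, abs_of_nonneg (hw1 X).1]
      exact (mul_le_of_le_one_left (abs_nonneg _) (hw1 X).2).trans (hC _))
  rw [stepMeasure] at hint ⊢
  rw [integral_add_measure hint.left_of_add_measure hint.right_of_add_measure,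
    integral_map h3.aemeasurable hh.aestronglyMeasurable,
    integral_map h4.aemeasurable hh.aestronglyMeasurable,
    integral_withDensity_eq_integral_toReal_smul h1 (ae_of_all _ fun _ => ENNReal.ofReal_lt_top),
    integral_withDensity_eq_integral_toReal_smul h2 (ae_of_all _ fun _ => ENNReal.ofReal_lt_top),
    kernelOp]
  simp only [ENNReal.toReal_ofReal (hg01 Λ _).1,
    ENNReal.toReal_ofReal (sub_nonneg.2 (hg01 Λ _).2), smul_eq_mul]
  exact integral_add (hb _ hgΛ (hg01 Λ) _ h3)
    (hb (fun X => 1 - g Λ X) (hgΛ.const_sub 1)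
      (fun X => ⟨sub_nonneg.2 (hg01 Λ X).2, sub_le_self _ (hg01 Λ X).1⟩) _ h4)

/-- The law of the chain after `n` steps, for the initial law `m`. -/
def chainLaw (d : ℕ) (ρ : ℝ) (Γ : Measure (Ed d)) (g : Ed d → Ed d → ℝ) (m : Measure (Ed d)) :
    ℕ → Measure (Ed d)
  | 0 => m
  | n + 1 => (chainLaw d ρ Γ g m n).bind (stepMeasure d ρ Γ g)

theorem isProbabilityMeasure_chainLaw [IsProbabilityMeasure Γ]
    (hg : Measurable (Function.uncurry g)) (hg01 : ∀ Λ X, g Λ X ∈ Icc (0 : ℝ) 1)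
    (m : Measure (Ed d)) [IsProbabilityMeasure m] (n : ℕ) :
    IsProbabilityMeasure (chainLaw d ρ Γ g m n) := by
  induction n with
  | zero => assumption
  | succ n ih =>
    exact isProbabilityMeasure_bind (measurable_stepMeasure hg).aemeasurable
      (ae_of_all _ (isProbabilityMeasure_stepMeasure hg hg01))

theorem lintegral_chainLaw_succ [SFinite Γ] (hg : Measurable (Function.uncurry g))
    (m : Measure (Ed d)) (n : ℕ) {φ : Ed d → ℝ≥0∞} (hφ : Measurable φ) :
    ∫⁻ y, φ y ∂chainLaw d ρ Γ g m (n + 1) =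
      ∫⁻ x, ∫⁻ y, φ y ∂stepMeasure d ρ Γ g x ∂chainLaw d ρ Γ g m n :=
  Measure.lintegral_bind (measurable_stepMeasure hg).aemeasurable hφ.aemeasurable

theorem measurable_lintegral_stepMeasure [SFinite Γ] (hg : Measurable (Function.uncurry g))
    {φ : Ed d → ℝ≥0∞} (hφ : Measurable φ) :
    Measurable fun x => ∫⁻ y, φ y ∂stepMeasure d ρ Γ g x :=
  (Measure.measurable_lintegral hφ).comp (measurable_stepMeasure hg)

theorem lintegral_chainLaw_add [SFinite Γ] (hg : Measurable (Function.uncurry g))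
    (m : Measure (Ed d)) (n k : ℕ) {φ : Ed d → ℝ≥0∞} (hφ : Measurable φ) :
    ∫⁻ y, φ y ∂chainLaw d ρ Γ g m (n + k) =
      ∫⁻ x, ∫⁻ y, φ y ∂chainLaw d ρ Γ g (Measure.dirac x) k ∂chainLaw d ρ Γ g m n := by
  induction k generalizing φ with
  | zero => simp [chainLaw, lintegral_dirac' _ hφ]
  | succ k ih =>
    rw [← add_assoc, lintegral_chainLaw_succ hg m (n + k) hφ,
      ih (measurable_lintegral_stepMeasure hg hφ)]
    simp only [lintegral_chainLaw_succ hg _ k hφ]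

theorem measurable_chainLaw_dirac [SFinite Γ] (hg : Measurable (Function.uncurry g)) (k : ℕ) :
    Measurable fun x => chainLaw d ρ Γ g (Measure.dirac x) k := by
  induction k with
  | zero => exact Measure.measurable_dirac
  | succ k ih => exact (Measure.measurable_bind' (measurable_stepMeasure hg)).comp ih

theorem integral_chainLaw_succ [IsProbabilityMeasure Γ]
    (hg : Measurable (Function.uncurry g)) (hg01 : ∀ Λ X, g Λ X ∈ Icc (0 : ℝ) 1)
    (m : Measure (Ed d)) [IsProbabilityMeasure m] (n : ℕ) {h : Ed d → ℝ} (hh : Measurable h)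
    {C : ℝ} (hC : ∀ x, |h x| ≤ C) :
    ∫ y, h y ∂chainLaw d ρ Γ g m (n + 1) =
      ∫ x, kernelOp d ρ Γ g h x ∂chainLaw d ρ Γ g m n := by
  have := isProbabilityMeasure_chainLaw (ρ := ρ) (Γ := Γ) hg hg01 m (n + 1)
  have hint : Integrable h (chainLaw d ρ Γ g m (n + 1)) :=
    Integrable.of_bound hh.aestronglyMeasurable C (ae_of_all _ hC)
  let κ : Kernel (Ed d) (Ed d) := ⟨stepMeasure d ρ Γ g, measurable_stepMeasure hg⟩
  have hκ : chainLaw d ρ Γ g m (n + 1) =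
      (κ ∘ₖ Kernel.const Unit (chainLaw d ρ Γ g m n)) () :=
    Measure.comp_eq_comp_const_apply (κ := κ)
  rw [hκ] at hint ⊢
  rw [ProbabilityTheory.Kernel.integral_comp hint, Kernel.const_apply]
  simp only [kernelOp_eq_integral_stepMeasure hg hg01 hh hC]
  rfl

theorem measurable_kernelOp [SFinite Γ] (hg : Measurable (Function.uncurry g)) {h : Ed d → ℝ}
    (hh : Measurable h) : Measurable (kernelOp d ρ Γ g h) := by
  have hg' : Measurable fun p : Ed d × Ed d => g p.1 p.2 := hg
  have : Measurable fun p : Ed d × Ed d =>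
      g p.1 p.2 * h (p.1 + (1 - ρ) • p.2) + (1 - g p.1 p.2) * h (p.1 - ρ • p.2) := by fun_prop
  exact (this.stronglyMeasurable.integral_prod_right (ν := Γ)).measurable

theorem abs_kernelOp_le [IsProbabilityMeasure Γ]
    (hg : Measurable (Function.uncurry g)) (hg01 : ∀ Λ X, g Λ X ∈ Icc (0 : ℝ) 1)
    {h : Ed d → ℝ} (hh : Measurable h) {C : ℝ} (hC : ∀ x, |h x| ≤ C) (Λ : Ed d) :
    |kernelOp d ρ Γ g h Λ| ≤ C := by
  have := isProbabilityMeasure_stepMeasure (ρ := ρ) hg hg01 Λ (Γ := Γ)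
  rw [kernelOp_eq_integral_stepMeasure hg hg01 hh hC]
  simpa using norm_integral_le_of_norm_le_const (μ := stepMeasure d ρ Γ g Λ) (f := h)
    (ae_of_all _ hC)

theorem integral_chainLaw [IsProbabilityMeasure Γ]
    (hg : Measurable (Function.uncurry g)) (hg01 : ∀ Λ X, g Λ X ∈ Icc (0 : ℝ) 1)
    (m : Measure (Ed d)) [IsProbabilityMeasure m] (n : ℕ) {h : Ed d → ℝ} (hh : Measurable h)
    {C : ℝ} (hC : ∀ x, |h x| ≤ C) :
    ∫ y, h y ∂chainLaw d ρ Γ g m n = ∫ x, (kernelOp d ρ Γ g)^[n] h x ∂m := by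
  induction n generalizing h with
  | zero => rfl
  | succ n ih =>
    rw [integral_chainLaw_succ hg hg01 m n hh hC, ih (measurable_kernelOp hg hh)
      (abs_kernelOp_le hg hg01 hh hC), Function.iterate_succ_apply]

end StepMeasure

/-! ### Smoothing component of the iterated kernel -/

section Minorization

variable {d : ℕ} {ρ : ℝ} {Γ : Measure (Ed d)} {g : Ed d → Ed d → ℝ}

instance [IsFiniteMeasure Γ] : IsFiniteMeasure (mixMeasure d ρ Γ) := by
  unfold mixMeasure
  have := Measure.smul_finite (Γ.map fun x => (1 - ρ) • x) (ENNReal.ofReal_ne_top (r := ρ))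
  have := Measure.smul_finite (Γ.map fun x => (-ρ) • x) (ENNReal.ofReal_ne_top (r := 1 - ρ))
  infer_instance

theorem lintegral_mixMeasure {φ : Ed d → ℝ≥0∞} (hφ : Measurable φ) :
    ∫⁻ y, φ y ∂mixMeasure d ρ Γ =
      ENNReal.ofReal ρ * ∫⁻ X, φ ((1 - ρ) • X) ∂Γ +
        ENNReal.ofReal (1 - ρ) * ∫⁻ X, φ ((-ρ) • X) ∂Γ := by
  rw [mixMeasure, lintegral_add_measure, lintegral_smul_measure, lintegral_smul_measure,
    lintegral_map hφ (by fun_prop), lintegral_map hφ (by fun_prop)]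
  rfl

theorem lintegral_convPow_succ [IsFiniteMeasure Γ] (n : ℕ) {φ : Ed d → ℝ≥0∞} (hφ : Measurable φ) :
    ∫⁻ y, φ y ∂convPow d (mixMeasure d ρ Γ) (n + 1) =
      ∫⁻ a, ∫⁻ b, φ (a + b) ∂mixMeasure d ρ Γ ∂convPow d (mixMeasure d ρ Γ) n := by
  have h1 : Measurable fun p : Ed d × Ed d => φ (p.1 + p.2) := hφ.comp (by fun_prop)
  rw [convPow, lintegral_map hφ (by fun_prop)]
  exact lintegral_prod _ h1.aemeasurable

theorem mul_lintegral_mixMeasure_le [IsFiniteMeasure Γ] (hρ : ρ ∈ Icc (0 : ℝ) 1)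
    (hg : Measurable (Function.uncurry g)) {c : ℝ} (hc : 0 ≤ c)
    (hgc : ∀ Λ X, c ≤ g Λ X ∧ c ≤ 1 - g Λ X) {φ : Ed d → ℝ≥0∞} (hφ : Measurable φ) (Λ : Ed d) :
    ENNReal.ofReal c * ∫⁻ z, φ (Λ + z) ∂mixMeasure d ρ Γ ≤
      ∫⁻ y, φ y ∂stepMeasure d ρ Γ g Λ := by
  have h1 : Measurable fun z => φ (Λ + z) := hφ.comp (by fun_prop)
  have h2 : Measurable fun X => φ (Λ + (1 - ρ) • X) := hφ.comp (by fun_prop)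
  have h3 : Measurable fun X => φ (Λ + (-ρ) • X) := hφ.comp (by fun_prop)
  rw [lintegral_mixMeasure h1, lintegral_stepMeasure hg hφ, mul_add, ← mul_assoc, ← mul_assoc,
    ← ENNReal.ofReal_mul hc, ← ENNReal.ofReal_mul hc, ← lintegral_const_mul _ h2,
    ← lintegral_const_mul _ h3, ← lintegral_add_left (h2.const_mul _)]
  refine lintegral_mono fun X => ?_
  simp only [neg_smul, ← sub_eq_add_neg]
  gcongr
  · exact (mul_le_of_le_one_right hc hρ.2).trans (hgc Λ X).1
  · exact (mul_le_of_le_one_right hc (by linarith [hρ.1])).trans (hgc Λ X).2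

theorem pow_mul_lintegral_convPow_le [IsFiniteMeasure Γ] (hρ : ρ ∈ Icc (0 : ℝ) 1)
    (hg : Measurable (Function.uncurry g)) {c : ℝ} (hc : 0 ≤ c)
    (hgc : ∀ Λ X, c ≤ g Λ X ∧ c ≤ 1 - g Λ X) (n : ℕ) {φ : Ed d → ℝ≥0∞} (hφ : Measurable φ)
    (Λ : Ed d) :
    ENNReal.ofReal c ^ n * ∫⁻ z, φ (Λ + z) ∂convPow d (mixMeasure d ρ Γ) n ≤
      ∫⁻ y, φ y ∂chainLaw d ρ Γ g (Measure.dirac Λ) n := by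
  induction n generalizing φ with
  | zero =>
    have h1 : Measurable fun z => φ (Λ + z) := hφ.comp (by fun_prop)
    simp [chainLaw, convPow, lintegral_dirac' _ hφ, lintegral_dirac' _ h1]
  | succ n ih =>
    have h1 : Measurable fun z => φ (Λ + z) := hφ.comp (by fun_prop)
    rw [lintegral_chainLaw_succ hg _ _ hφ, lintegral_convPow_succ _ h1]
    refine le_trans ?_ (ih (measurable_lintegral_stepMeasure hg hφ))
    have h2 : Measurable fun a => ∫⁻ b, φ (Λ + (a + b)) ∂mixMeasure d ρ Γ :=
      Measurable.lintegral_prod_right (f := fun a b => φ (Λ + (a + b)))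
        (hφ.comp (by fun_prop : Measurable fun p : Ed d × Ed d => Λ + (p.1 + p.2)))
    rw [pow_succ, mul_assoc, ← lintegral_const_mul _ h2]
    gcongr with a
    simpa only [add_assoc] using mul_lintegral_mixMeasure_le hρ hg hc hgc hφ (Λ + a)

/-- A nonzero density has a nonzero part which is bounded by `1` and supported in a ball. -/
theorem exists_lintegral_truncation_ne_zero {f : Ed d → ℝ≥0∞} (hf : Measurable f)
    (h : ∫⁻ x, f x ≠ 0) :
    ∃ N : ℕ, ∫⁻ x, (Metric.closedBall (0 : Ed d) N).indicator (fun x => min (f x) 1) x ≠ 0 := by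
  by_contra! hcon
  apply h
  have hm : ∀ N : ℕ, Measurable
      ((Metric.closedBall (0 : Ed d) N).indicator fun x => min (f x) 1) := fun N =>
    (hf.min measurable_const).indicator Metric.isClosed_closedBall.measurableSet
  rw [lintegral_eq_zero_iff hf]
  have hae := ae_all_iff.2 fun N => (lintegral_eq_zero_iff (hm N)).1 (hcon N)
  filter_upwards [hae] with x hx
  obtain ⟨N, hN⟩ := exists_nat_ge ‖x‖
  have := hx N
  rw [indicator_of_mem (by simpa using hN)] at this
  simpa using this

/-- If the mixture `Γ_ρ` is spread out, some iterate of the kernel dominates a translation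
invariant kernel with a bounded and compactly supported density. -/
theorem exists_smoothing_minorant [IsProbabilityMeasure Γ] (hρ : ρ ∈ Icc (0 : ℝ) 1)
    (hg : Measurable (Function.uncurry g)) {c : ℝ} (hc : 0 < c)
    (hgc : ∀ Λ X, c ≤ g Λ X ∧ c ≤ 1 - g Λ X) (hso : SpreadOut d (mixMeasure d ρ Γ)) :
    ∃ (k : ℕ) (T : Ed d → Measure (Ed d)) (t a : ℝ≥0∞) (N : ℝ), Measurable T ∧
      (∀ x, T x ≤ chainLaw d ρ Γ g (Measure.dirac x) k) ∧ (∀ x, T x univ = t) ∧ t ≠ 0 ∧ a ≠ ∞ ∧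
      ∀ (φ : Ed d → ℝ≥0∞), Measurable φ → ∀ (M : ℝ) (x : Ed d), ‖x‖ ≤ M →
        ∫⁻ y, φ y ∂T x ≤ a * ∫⁻ y in Metric.closedBall 0 (M + N), φ y := by
  obtain ⟨k, -, f, hf, hf0, hfpos, hdom⟩ := hso
  have hfint : Integrable f := by
    by_contra hni
    simp [integral_undef hni] at hfpos
  have hfm : Measurable fun x => ENNReal.ofReal (f x) := by fun_prop
  have hne : ∫⁻ x, ENNReal.ofReal (f x) ≠ 0 := by
    rw [← ofReal_integral_eq_lintegral_ofReal hfint (ae_of_all _ hf0)]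
    simpa using hfpos
  obtain ⟨N, hN⟩ := exists_lintegral_truncation_ne_zero hfm hne
  set B : Set (Ed d) := Metric.closedBall 0 N with hB
  have hBm : MeasurableSet B := Metric.isClosed_closedBall.measurableSet
  set p : Ed d → ℝ≥0∞ := B.indicator fun x => min (ENNReal.ofReal (f x)) 1 with hp
  have hpm : Measurable p := (hfm.min measurable_const).indicator hBm
  set a : ℝ≥0∞ := ENNReal.ofReal c ^ k with ha
  let T : Ed d → Measure (Ed d) := fun x => a • (volume.withDensity p).map (x + ·)
  have hT : ∀ φ : Ed d → ℝ≥0∞, Measurable φ → ∀ x, ∫⁻ y, φ y ∂T x = a * ∫⁻ z, p z * φ (x + z) := by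
    intro φ hφ x
    have h1 : Measurable fun z => φ (x + z) := hφ.comp (by fun_prop)
    rw [lintegral_smul_measure, lintegral_map hφ (by fun_prop),
      lintegral_withDensity_eq_lintegral_mul _ hpm h1]
    rfl
  refine ⟨k, T, a * ∫⁻ z, p z, a, N, ?_, ?_, ?_, ?_, ?_, ?_⟩
  · refine Measure.measurable_of_measurable_coe _ fun s hs => ?_
    have hi : Measurable (s.indicator (1 : Ed d → ℝ≥0∞)) := measurable_one.indicator hs
    simp only [← lintegral_indicator_one hs, hT _ hi]
    refine Measurable.const_mul (Measurable.lintegral_prod_right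
      (f := fun x z => p z * s.indicator (1 : Ed d → ℝ≥0∞) (x + z)) ?_) _
    exact (hpm.comp measurable_snd).mul
      (hi.comp (by fun_prop : Measurable fun q : Ed d × Ed d => q.1 + q.2))
  · intro x
    refine Measure.le_iff.2 fun s hs => ?_
    have hi : Measurable (s.indicator (1 : Ed d → ℝ≥0∞)) := measurable_one.indicator hs
    have hpre : MeasurableSet ((x + ·) ⁻¹' s) := (measurable_const_add x) hs
    rw [← lintegral_indicator_one hs, ← lintegral_indicator_one hs, hT _ hi]
    refine le_trans ?_ (pow_mul_lintegral_convPow_le hρ hg hc.le hgc k hi x)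
    refine mul_le_mul' le_rfl ?_
    calc ∫⁻ z, p z * s.indicator 1 (x + z)
        ≤ ∫⁻ z in (x + ·) ⁻¹' s, ENNReal.ofReal (f z) := by
          rw [← lintegral_indicator hpre]
          refine lintegral_mono fun z => ?_
          by_cases hz : x + z ∈ s
          · rw [indicator_of_mem hz, indicator_of_mem (show z ∈ (x + ·) ⁻¹' s from hz),
              Pi.one_apply, mul_one]
            exact indicator_le (fun _ _ => min_le_left _ _) z
          · simp [indicator_of_notMem hz]
      _ = ENNReal.ofReal (∫ z in (x + ·) ⁻¹' s, f z) :=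
          (ofReal_integral_eq_lintegral_ofReal hfint.integrableOn (ae_of_all _ hf0)).symm
      _ ≤ convPow d (mixMeasure d ρ Γ) k ((x + ·) ⁻¹' s) := hdom _ hpre
      _ = ∫⁻ z, s.indicator 1 (x + z) ∂convPow d (mixMeasure d ρ Γ) k := by
          rw [← lintegral_indicator_one hpre]
          rfl
  · intro x
    rw [← lintegral_one, hT _ measurable_const]
    simp
  · exact mul_ne_zero (pow_ne_zero _ (by simpa using hc)) hN
  · exact ENNReal.pow_ne_top ENNReal.ofReal_ne_top
  · intro φ hφ M x hx
    rw [hT φ hφ]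
    refine mul_le_mul' le_rfl ?_
    rw [← lintegral_indicator Metric.isClosed_closedBall.measurableSet,
      ← lintegral_add_left_eq_self ((Metric.closedBall 0 (M + N)).indicator φ) x]
    refine lintegral_mono fun z => ?_
    by_cases hz : z ∈ B
    · have hxz : x + z ∈ Metric.closedBall (0 : Ed d) (M + N) := by
        rw [mem_closedBall_zero_iff] at hz ⊢
        exact (norm_add_le _ _).trans (add_le_add hx hz)
      rw [indicator_of_mem hxz, hp, indicator_of_mem hz]
      exact mul_le_of_le_one_left zero_le (min_le_right _ _)
    · simp [hp, indicator_of_notMem hz]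

end Minorization

/-! ### Cesàro averages of the chain -/

section Cesaro

variable {d : ℕ} {ρ : ℝ} {Γ : Measure (Ed d)} {g : Ed d → Ed d → ℝ}

/-- The average of the laws of the first `n + 1` positions of the chain started at `Λ`. -/
def cesaroLaw (d : ℕ) (ρ : ℝ) (Γ : Measure (Ed d)) (g : Ed d → Ed d → ℝ) (Λ : Ed d) (n : ℕ) :
    Measure (Ed d) :=
  ((n + 1 : ℕ) : ℝ≥0∞)⁻¹ • ∑ i ∈ Finset.range (n + 1), chainLaw d ρ Γ g (Measure.dirac Λ) i

theorem lintegral_cesaroLaw (Λ : Ed d) (n : ℕ) (φ : Ed d → ℝ≥0∞) :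
    ∫⁻ x, φ x ∂cesaroLaw d ρ Γ g Λ n = ((n + 1 : ℕ) : ℝ≥0∞)⁻¹ *
      ∑ i ∈ Finset.range (n + 1), ∫⁻ x, φ x ∂chainLaw d ρ Γ g (Measure.dirac Λ) i := by
  rw [cesaroLaw, lintegral_smul_measure, lintegral_finsetSum_measure, smul_eq_mul]

theorem isProbabilityMeasure_cesaroLaw [IsProbabilityMeasure Γ]
    (hg : Measurable (Function.uncurry g)) (hg01 : ∀ Λ X, g Λ X ∈ Icc (0 : ℝ) 1)
    (Λ : Ed d) (n : ℕ) : IsProbabilityMeasure (cesaroLaw d ρ Γ g Λ n) := by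
  have := isProbabilityMeasure_chainLaw (ρ := ρ) (Γ := Γ) hg hg01 (Measure.dirac Λ)
  refine ⟨?_⟩
  rw [← lintegral_one, lintegral_cesaroLaw]
  simp only [lintegral_one, measure_univ, Finset.sum_const, Finset.card_range, nsmul_eq_mul,
    mul_one]
  exact ENNReal.inv_mul_cancel (by simp) (ENNReal.natCast_ne_top _)

theorem tendsto_inv_natCast_succ_mul_zero (k : ℕ) {s : ℕ → ℝ≥0∞} (hs : ∀ n, s n ≤ k) :
    Tendsto (fun n : ℕ => ((n + 1 : ℕ) : ℝ≥0∞)⁻¹ * s n) atTop (nhds 0) := by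
  have h1 : Tendsto (fun n : ℕ => ((n + 1 : ℕ) : ℝ≥0∞)⁻¹ * k) atTop (nhds 0) := by
    have := ENNReal.Tendsto.mul_const (b := (k : ℝ≥0∞))
      ((tendsto_add_atTop_iff_nat 1).2 ENNReal.tendsto_inv_nat_nhds_zero)
      (Or.inr (ENNReal.natCast_ne_top k))
    simpa using this
  exact tendsto_of_tendsto_of_tendsto_of_le_of_le tendsto_const_nhds h1 (fun _ => zero_le)
    fun n => mul_le_mul' le_rfl (hs n)

/-- Limits of Cesàro averages are invariant under every iterate of the kernel. -/
theorem ultraLim_cesaroLaw_chainLaw [IsProbabilityMeasure Γ]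
    (hg : Measurable (Function.uncurry g)) (hg01 : ∀ Λ X, g Λ X ∈ Icc (0 : ℝ) 1) (Λ : Ed d)
    {U : Ultrafilter ℕ} (hU : (U : Filter ℕ) ≤ atTop) (k : ℕ) {φ : Ed d → ℝ≥0∞}
    (hφ : Measurable φ) (hφ1 : ∀ x, φ x ≤ 1) :
    ultraLim U (cesaroLaw d ρ Γ g Λ)
        (fun x => ∫⁻ y, φ y ∂chainLaw d ρ Γ g (Measure.dirac x) k) =
      ultraLim U (cesaroLaw d ρ Γ g Λ) φ := by
  have := isProbabilityMeasure_chainLaw (ρ := ρ) (Γ := Γ) hg hg01 (Measure.dirac Λ)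
  set a : ℕ → ℝ≥0∞ := fun i => ∫⁻ x, φ x ∂chainLaw d ρ Γ g (Measure.dirac Λ) i with ha
  have ha1 : ∀ i, a i ≤ 1 := fun i => (lintegral_mono hφ1).trans (by simp)
  have hsum : ∀ s : ℕ → ℕ, ∑ i ∈ Finset.range k, a (s i) ≤ k := fun s =>
    (Finset.sum_le_sum fun i _ => ha1 (s i)).trans (by simp)
  have h1 := (tendsto_ultraLim U (cesaroLaw d ρ Γ g Λ)
    (fun x => ∫⁻ y, φ y ∂chainLaw d ρ Γ g (Measure.dirac x) k)).add
    ((tendsto_inv_natCast_succ_mul_zero k fun _ => hsum id).mono_left hU)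
  have h2 := (tendsto_ultraLim U (cesaroLaw d ρ Γ g Λ) φ).add
    ((tendsto_inv_natCast_succ_mul_zero k fun n => hsum (n + 1 + ·)).mono_left hU)
  rw [add_zero] at h1 h2
  refine tendsto_nhds_unique h1 (h2.congr fun n => ?_)
  rw [lintegral_cesaroLaw, lintegral_cesaroLaw, ← mul_add, ← mul_add,
    ← Finset.sum_range_add a (n + 1) k, add_comm (n + 1) k, Finset.sum_range_add a k (n + 1),
    add_comm (∑ i ∈ Finset.range k, a i)]
  congr 2
  refine Finset.sum_congr rfl fun i _ => ?_
  rw [← lintegral_chainLaw_add hg _ i k hφ, add_comm]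

/-- Under tightness, every limit of the Cesàro averages is given by an invariant measure. -/
theorem exists_isInvariantMeasure_eq_ultraLim [IsProbabilityMeasure Γ] (hρ : ρ ∈ Icc (0 : ℝ) 1)
    (hg : Measurable (Function.uncurry g)) {c : ℝ} (hc : 0 < c)
    (hgc : ∀ Λ X, c ≤ g Λ X ∧ c ≤ 1 - g Λ X) (hso : SpreadOut d (mixMeasure d ρ Γ)) (Λ : Ed d)
    (htight : ∀ ε : ℝ≥0∞, ε ≠ 0 → ∃ M : ℝ, ∀ n, cesaroLaw d ρ Γ g Λ n {x | M < ‖x‖} ≤ ε)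
    {U : Ultrafilter ℕ} (hU : (U : Filter ℕ) ≤ atTop) :
    ∃ ν : Measure (Ed d), IsProbabilityMeasure ν ∧ IsInvariantMeasure d ρ Γ g ν ∧
      ∀ φ : Ed d → ℝ≥0∞, Measurable φ → ∀ b : ℝ≥0∞, b ≠ ∞ → (∀ x, φ x ≤ b) →
        ultraLim U (cesaroLaw d ρ Γ g Λ) φ = ∫⁻ x, φ x ∂ν := by
  have hg01 : ∀ Λ X, g Λ X ∈ Icc (0 : ℝ) 1 := fun Λ X =>
    ⟨hc.le.trans (hgc Λ X).1, by linarith [(hgc Λ X).2]⟩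
  have := isProbabilityMeasure_cesaroLaw (ρ := ρ) (Γ := Γ) hg hg01 Λ
  have hK : ∀ (k : ℕ) x, IsProbabilityMeasure (chainLaw d ρ Γ g (Measure.dirac x) k) :=
    fun k x => isProbabilityMeasure_chainLaw hg hg01 _ k
  obtain ⟨k, T, t, a, N, hT, hTK, hTt, ht, ha, hTle⟩ := exists_smoothing_minorant hρ hg hc hgc hso
  have hreg : ∀ φ : ℕ → Ed d → ℝ≥0∞, DecreasesToZero 1 φ →
      ⨅ j, ultraLim U (cesaroLaw d ρ Γ g Λ) (fun x => ∫⁻ y, φ j y ∂T x) = 0 := by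
    intro φ hφ
    refine le_antisymm (le_of_forall_pos_le_add fun ε hε => ?_) zero_le
    obtain ⟨M, hM⟩ := htight ε hε.ne'
    have hT1 : ∀ j x, ∫⁻ y, φ j y ∂T x ≤ 1 := fun j x =>
      (lintegral_mono' (hTK x) (hφ.le j)).trans (by have := hK k x; simp)
    have hbound : ∀ j, ultraLim U (cesaroLaw d ρ Γ g Λ) (fun x => ∫⁻ y, φ j y ∂T x) ≤
        a * (∫⁻ y in Metric.closedBall 0 (M + N), φ j y) + ε := by
      intro j
      refine le_of_tendsto' (tendsto_ultraLim U _ _) fun n => ?_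
      have hset : MeasurableSet {x : Ed d | M < ‖x‖} :=
        measurableSet_lt measurable_const measurable_norm
      calc ∫⁻ x, ∫⁻ y, φ j y ∂T x ∂cesaroLaw d ρ Γ g Λ n
          ≤ ∫⁻ x, (a * ∫⁻ y in Metric.closedBall 0 (M + N), φ j y) +
              {x : Ed d | M < ‖x‖}.indicator 1 x ∂cesaroLaw d ρ Γ g Λ n := by
            refine lintegral_mono fun x => ?_
            rcases le_or_gt ‖x‖ M with hx | hx
            · exact (hTle _ (hφ.measurable j) M x hx).trans le_self_add
            · rw [indicator_of_mem (show x ∈ {x : Ed d | M < ‖x‖} from hx)]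
              exact (hT1 j x).trans le_add_self
        _ ≤ _ := by
            rw [lintegral_add_left measurable_const, lintegral_const, measure_univ, mul_one,
              lintegral_indicator_one hset]
            exact add_le_add le_rfl (hM n)
    have hfin : IsFiniteMeasure (volume.restrict (Metric.closedBall (0 : Ed d) (M + N))) :=
      ⟨by simpa using measure_closedBall_lt_top⟩
    calc ⨅ j, ultraLim U (cesaroLaw d ρ Γ g Λ) (fun x => ∫⁻ y, φ j y ∂T x)
        ≤ ⨅ j, (a * (∫⁻ y in Metric.closedBall 0 (M + N), φ j y) + ε) := iInf_mono hbound
      _ = 0 + ε := by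
        rw [← ENNReal.iInf_add, ← ENNReal.mul_iInf fun h => absurd h ha,
          iInf_lintegral_eq_zero ENNReal.one_ne_top hφ, mul_zero]
  obtain ⟨ν, hν, hνeq⟩ := exists_measure_eq_ultraLim (U := U) (μ := cesaroLaw d ρ Γ g Λ)
    (iInf_ultraLim_eq_zero (measurable_chainLaw_dirac hg k) hT (hK k) hTK hTt ht
      (fun φ hφ hφ1 => ultraLim_cesaroLaw_chainLaw hg hg01 Λ hU k hφ hφ1) hreg)
  refine ⟨ν, hν, fun A hA => ?_, hνeq⟩
  have hstep : ∀ x, IsProbabilityMeasure (stepMeasure d ρ Γ g x) :=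
    isProbabilityMeasure_stepMeasure hg hg01
  have hind : Measurable (A.indicator fun _ => (1 : ℝ≥0∞)) := measurable_const.indicator hA
  have hle : ∀ x, A.indicator (fun _ => (1 : ℝ≥0∞)) x ≤ 1 :=
    indicator_le_self' fun _ _ => zero_le
  have hmeas := measurable_lintegral_stepMeasure (ρ := ρ) (Γ := Γ) hg hind
  have hone : ∀ x, chainLaw d ρ Γ g (Measure.dirac x) 1 = stepMeasure d ρ Γ g x := fun x =>
    Measure.dirac_bind (measurable_stepMeasure hg) x
  have hinv := ultraLim_cesaroLaw_chainLaw (ρ := ρ) (Γ := Γ) hg hg01 Λ hU 1 hind hle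
  simp only [hone] at hinv
  rw [hνeq _ hind 1 ENNReal.one_ne_top hle,
    hνeq _ hmeas 1 ENNReal.one_ne_top fun x => (lintegral_mono hle).trans (by simp)] at hinv
  simp only [lintegral_indicator_const hA, one_mul] at hinv
  have hkernel : ∀ x, kernelOp d ρ Γ g (A.indicator fun _ => (1 : ℝ)) x =
      (stepMeasure d ρ Γ g x A).toReal := fun x => by
    rw [kernelOp_eq_integral_stepMeasure hg hg01 (measurable_const.indicator hA) (C := 1)
      (fun y => by by_cases hy : y ∈ A <;> simp [hy]), integral_indicator_const _ hA]
    simp [Measure.real]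
  simp only [hkernel]
  have hA' : Measurable fun x => stepMeasure d ρ Γ g x A :=
    (Measure.measurable_coe hA).comp (measurable_stepMeasure hg)
  rw [integral_toReal hA'.aemeasurable (ae_of_all _ fun x => measure_lt_top _ _), hinv]

theorem tendsto_lintegral_cesaroLaw [IsProbabilityMeasure Γ] (hρ : ρ ∈ Icc (0 : ℝ) 1)
    (hg : Measurable (Function.uncurry g)) {c : ℝ} (hc : 0 < c)
    (hgc : ∀ Λ X, c ≤ g Λ X ∧ c ≤ 1 - g Λ X) (hso : SpreadOut d (mixMeasure d ρ Γ)) (Λ : Ed d)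
    (htight : ∀ ε : ℝ≥0∞, ε ≠ 0 → ∃ M : ℝ, ∀ n, cesaroLaw d ρ Γ g Λ n {x | M < ‖x‖} ≤ ε)
    {π : Measure (Ed d)} (huniq : ∀ π' : Measure (Ed d), IsProbabilityMeasure π' →
      IsInvariantMeasure d ρ Γ g π' → π' = π)
    {φ : Ed d → ℝ≥0∞} (hφ : Measurable φ) {b : ℝ≥0∞} (hb : b ≠ ∞) (hφb : ∀ x, φ x ≤ b) :
    Tendsto (fun n => ∫⁻ x, φ x ∂cesaroLaw d ρ Γ g Λ n) atTop (nhds (∫⁻ x, φ x ∂π)) := by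
  rw [tendsto_iff_ultrafilter]
  intro U hU
  obtain ⟨ν, hν, hνinv, hνeq⟩ :=
    exists_isInvariantMeasure_eq_ultraLim hρ hg hc hgc hso Λ htight hU
  rw [← huniq ν hν hνinv, ← hνeq φ hφ b hb hφb]
  exact tendsto_ultraLim U _ φ

theorem integral_cesaroLaw [IsProbabilityMeasure Γ]
    (hg : Measurable (Function.uncurry g)) (hg01 : ∀ Λ X, g Λ X ∈ Icc (0 : ℝ) 1) (Λ : Ed d)
    (n : ℕ) {h : Ed d → ℝ} (hh : Measurable h) {C : ℝ} (hC : ∀ x, |h x| ≤ C) :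
    ∫ x, h x ∂cesaroLaw d ρ Γ g Λ n = ((n + 1 : ℕ) : ℝ)⁻¹ *
      ∑ i ∈ Finset.range (n + 1), (kernelOp d ρ Γ g)^[i] h Λ := by
  have := isProbabilityMeasure_chainLaw (ρ := ρ) (Γ := Γ) hg hg01 (Measure.dirac Λ)
  rw [cesaroLaw, integral_smul_measure, integral_finsetSum_measure fun i _ =>
    Integrable.of_bound hh.aestronglyMeasurable C (ae_of_all _ hC)]
  have hit : ∀ i, Measurable ((kernelOp d ρ Γ g)^[i] h) := fun i => by
    induction i with
    | zero => exact hh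
    | succ i ih => rw [Function.iterate_succ_apply']; exact measurable_kernelOp hg ih
  simp only [integral_chainLaw hg hg01 _ _ hh hC, integral_dirac' _ _ (hit _).stronglyMeasurable]
  rw [ENNReal.toReal_inv, ENNReal.toReal_natCast, smul_eq_mul]

/-- Ergodic theorem for the chain: Cesàro averages of a bounded function converge. -/
theorem tendsto_average_iterate_kernelOp [IsProbabilityMeasure Γ] (hρ : ρ ∈ Icc (0 : ℝ) 1)
    (hg : Measurable (Function.uncurry g)) {c : ℝ} (hc : 0 < c)
    (hgc : ∀ Λ X, c ≤ g Λ X ∧ c ≤ 1 - g Λ X) (hso : SpreadOut d (mixMeasure d ρ Γ)) (Λ : Ed d)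
    (htight : ∀ ε : ℝ≥0∞, ε ≠ 0 → ∃ M : ℝ, ∀ n, cesaroLaw d ρ Γ g Λ n {x | M < ‖x‖} ≤ ε)
    {π : Measure (Ed d)} [IsProbabilityMeasure π]
    (huniq : ∀ π' : Measure (Ed d), IsProbabilityMeasure π' →
      IsInvariantMeasure d ρ Γ g π' → π' = π)
    {h : Ed d → ℝ} (hh : Measurable h) {C : ℝ} (hC : ∀ x, |h x| ≤ C) :
    Tendsto (fun n : ℕ => (n : ℝ)⁻¹ * ∑ i ∈ Finset.range n, (kernelOp d ρ Γ g)^[i] h Λ) atTop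
      (nhds (∫ x, h x ∂π)) := by
  have hg01 : ∀ Λ X, g Λ X ∈ Icc (0 : ℝ) 1 := fun Λ X =>
    ⟨hc.le.trans (hgc Λ X).1, by linarith [(hgc Λ X).2]⟩
  have := isProbabilityMeasure_cesaroLaw (ρ := ρ) (Γ := Γ) hg hg01 Λ
  have key : ∀ (m : Measure (Ed d)) [IsProbabilityMeasure m],
      (∫⁻ x, ENNReal.ofReal (h x + C) ∂m).toReal - C = ∫ x, h x ∂m := by
    intro m _
    have hint : Integrable h m := Integrable.of_bound hh.aestronglyMeasurable C (ae_of_all _ hC)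
    rw [← integral_toReal (by fun_prop) (ae_of_all _ fun _ => ENNReal.ofReal_lt_top),
      integral_congr_ae (ae_of_all _ fun x =>
        ENNReal.toReal_ofReal (by linarith [neg_le_of_abs_le (hC x)] : 0 ≤ h x + C)),
      integral_add hint (integrable_const C)]
    simp
  have hle : ∀ x, ENNReal.ofReal (h x + C) ≤ ENNReal.ofReal (C + C) := fun x =>
    ENNReal.ofReal_le_ofReal (by linarith [le_of_abs_le (hC x)])
  have hlim := tendsto_lintegral_cesaroLaw hρ hg hc hgc hso Λ htight huniq
    (φ := fun x => ENNReal.ofReal (h x + C)) (by fun_prop) ENNReal.ofReal_ne_top hle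
  have hfin : ∫⁻ x, ENNReal.ofReal (h x + C) ∂π ≠ ∞ :=
    ((lintegral_mono hle).trans_lt (by simp)).ne
  have hlim' := ((ENNReal.tendsto_toReal hfin).comp hlim).sub_const C
  rw [key π] at hlim'
  refine (tendsto_add_atTop_iff_nat 1).1 (hlim'.congr fun n => ?_)
  rw [Function.comp_apply, key, integral_cesaroLaw hg hg01 Λ n hh hC]

end Cesaro

/-! ### Drift and tightness -/

section Drift

variable {d : ℕ} {ρ : ℝ} {Γ : Measure (Ed d)} {g : Ed d → Ed d → ℝ}

/-- A drift towards the origin makes the Cesàro averages of the chain tight. -/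
theorem exists_cesaroLaw_norm_gt_le [IsProbabilityMeasure Γ]
    (hg : Measurable (Function.uncurry g)) (hg01 : ∀ Λ X, g Λ X ∈ Icc (0 : ℝ) 1)
    {V : Ed d → ℝ≥0∞} (hV : Measurable V) (hVfin : ∀ x, V x ≠ ∞) {ε : ℝ} (hε : 0 < ε)
    {K : ℝ≥0∞} (hK : K ≠ ∞)
    (hdrift : ∀ x, ∫⁻ y, V y ∂stepMeasure d ρ Γ g x + ENNReal.ofReal (ε * ‖x‖) ≤ V x + K)
    (Λ : Ed d) {η : ℝ≥0∞} (hη : η ≠ 0) :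
    ∃ M : ℝ, ∀ n, cesaroLaw d ρ Γ g Λ n {x | M < ‖x‖} ≤ η := by
  have hprob := isProbabilityMeasure_chainLaw (ρ := ρ) (Γ := Γ) hg hg01 (Measure.dirac Λ)
  have hb : Measurable fun x : Ed d => ENNReal.ofReal (ε * ‖x‖) := by fun_prop
  have hstep : ∀ n, ∫⁻ x, V x ∂chainLaw d ρ Γ g (Measure.dirac Λ) (n + 1) +
      ∫⁻ x, ENNReal.ofReal (ε * ‖x‖) ∂chainLaw d ρ Γ g (Measure.dirac Λ) n ≤
      ∫⁻ x, V x ∂chainLaw d ρ Γ g (Measure.dirac Λ) n + K := by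
    intro n
    rw [lintegral_chainLaw_succ hg _ _ hV, ← lintegral_add_right _ hb]
    refine (lintegral_mono hdrift).trans ?_
    rw [lintegral_add_left hV]
    simp
  have hsum : ∀ n : ℕ, ∫⁻ x, V x ∂chainLaw d ρ Γ g (Measure.dirac Λ) n +
      ∑ i ∈ Finset.range n, ∫⁻ x, ENNReal.ofReal (ε * ‖x‖) ∂chainLaw d ρ Γ g (Measure.dirac Λ) i ≤
      V Λ + n * K := by
    intro n
    induction n with
    | zero => simp [chainLaw, lintegral_dirac' _ hV]
    | succ n ih =>
      rw [Finset.sum_range_succ, add_comm (∑ i ∈ Finset.range n, _), ← add_assoc]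
      refine (add_le_add (hstep n) le_rfl).trans ?_
      rw [add_right_comm]
      refine (add_le_add ih le_rfl).trans_eq ?_
      push_cast
      ring
  have hces : ∀ n, ∫⁻ x, ENNReal.ofReal (ε * ‖x‖) ∂cesaroLaw d ρ Γ g Λ n ≤ V Λ + K := by
    intro n
    rw [lintegral_cesaroLaw, ENNReal.inv_mul_le_iff (by simp) (ENNReal.natCast_ne_top _), mul_add]
    refine (le_add_self.trans (hsum (n + 1))).trans (add_le_add ?_ le_rfl)
    exact le_mul_of_one_le_left zero_le (by simp)
  obtain ⟨m, hm⟩ := ENNReal.exists_nat_mul_gt hη (ENNReal.add_ne_top.2 ⟨hVfin Λ, hK⟩)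
  have hm0 : (m : ℝ≥0∞) ≠ 0 := by
    rintro h
    simp [h] at hm
  refine ⟨m / ε, fun n => ?_⟩
  have hsub : {x : Ed d | m / ε < ‖x‖} ⊆ {x | (m : ℝ≥0∞) ≤ ENNReal.ofReal (ε * ‖x‖)} := by
    intro x hx
    rw [mem_ofPred_eq, div_lt_iff₀' hε] at hx
    rw [mem_ofPred_eq, ← ENNReal.ofReal_natCast]
    exact ENNReal.ofReal_le_ofReal hx.le
  have hmarkov := (mul_le_mul' le_rfl (measure_mono hsub)).trans
    ((mul_meas_ge_le_lintegral (μ := cesaroLaw d ρ Γ g Λ n) hb m).trans ((hces n).trans hm.le))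
  exact (ENNReal.mul_le_mul_iff_right hm0 (ENNReal.natCast_ne_top m)).1 hmarkov

theorem integrable_norm_pow_of_subExp [IsFiniteMeasure Γ] (h : SubExp d Γ) :
    Integrable (fun x => ‖x‖) Γ ∧ Integrable (fun x => ‖x‖ ^ 2) Γ := by
  obtain ⟨l, hl, hint⟩ := h
  have hexp : ∀ x : Ed d, 1 + l * ‖x‖ + (l * ‖x‖) ^ 2 / 2 ≤ Real.exp (l * ‖x‖) := fun x =>
    Real.quadratic_le_exp_of_nonneg (by positivity)
  constructor
  · refine (hint.const_mul l⁻¹).mono' (by fun_prop) (ae_of_all _ fun x => ?_)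
    rw [norm_norm, ← div_eq_inv_mul, le_div_iff₀' hl]
    linarith [hexp x, sq_nonneg (l * ‖x‖)]
  · refine (hint.const_mul (2 / l ^ 2)).mono' (by fun_prop) (ae_of_all _ fun x => ?_)
    rw [Real.norm_of_nonneg (by positivity), div_mul_eq_mul_div, le_div_iff₀' (by positivity)]
    nlinarith [hexp x, mul_nonneg hl.le (norm_nonneg x)]

/-- A measure whose mixture is spread out is not carried by a proper subspace. -/
theorem SpreadOut.not_ae_mem [IsFiniteMeasure Γ] (hso : SpreadOut d (mixMeasure d ρ Γ))
    {S : Submodule ℝ (Ed d)} (hS : S ≠ ⊤) : ¬ ∀ᵐ x ∂Γ, x ∈ S := by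
  intro hae
  have hSm : MeasurableSet ((S : Set (Ed d))ᶜ) :=
    (Submodule.closed_of_finiteDimensional S).measurableSet.compl
  set φ : Ed d → ℝ≥0∞ := (S : Set (Ed d))ᶜ.indicator 1 with hφdef
  have hφ : Measurable φ := measurable_one.indicator hSm
  have hφ0 : ∀ x ∈ S, φ x = 0 := fun x hx => indicator_of_notMem (by simpa using hx) _
  have hmix : ∫⁻ y, φ y ∂mixMeasure d ρ Γ = 0 := by
    have hzero : ∀ r : ℝ, ∫⁻ X, φ (r • X) ∂Γ = 0 := fun r =>
      (lintegral_congr_ae (hae.mono fun x hx => hφ0 _ (S.smul_mem r hx))).trans lintegral_zero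
    rw [lintegral_mixMeasure hφ, hzero, hzero]
    simp
  have hsub : ∀ a b, φ (a + b) ≤ φ a + φ b := by
    intro a b
    by_cases ha : a ∈ S
    · by_cases hb : b ∈ S
      · simp [hφ0 _ (S.add_mem ha hb)]
      · rw [hφdef, indicator_of_mem (show b ∈ (S : Set (Ed d))ᶜ from hb)]
        exact (indicator_le_self' (fun _ _ => zero_le) _).trans le_add_self
    · rw [hφdef, indicator_of_mem (show a ∈ (S : Set (Ed d))ᶜ from ha)]
      exact (indicator_le_self' (fun _ _ => zero_le) _).trans le_self_add
  have hconv : ∀ n, ∫⁻ y, φ y ∂convPow d (mixMeasure d ρ Γ) n = 0 := by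
    intro n
    induction n with
    | zero => simp [convPow, lintegral_dirac' _ hφ, hφ0 0 S.zero_mem]
    | succ n ih =>
      rw [lintegral_convPow_succ n hφ, ← le_zero_iff]
      calc ∫⁻ a, ∫⁻ b, φ (a + b) ∂mixMeasure d ρ Γ ∂convPow d (mixMeasure d ρ Γ) n
          ≤ ∫⁻ a, φ a * mixMeasure d ρ Γ univ ∂convPow d (mixMeasure d ρ Γ) n := by
            refine lintegral_mono fun a => (lintegral_mono (hsub a)).trans ?_
            rw [lintegral_add_left measurable_const, hmix, lintegral_const, add_zero]
        _ = 0 := by rw [lintegral_mul_const _ hφ, ih, zero_mul]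
  obtain ⟨k, -, f, -, -, hfpos, hdom⟩ := hso
  have hvol : volume (S : Set (Ed d)) = 0 := Measure.addHaar_submodule _ S hS
  have hk := hdom _ hSm
  rw [← lintegral_indicator_one hSm, hconv k, nonpos_iff_eq_zero, ENNReal.ofReal_eq_zero,
    setIntegral_congr_set (compl_mem_ae_iff.2 hvol |> fun h => eventuallyEq_univ.2 h),
    setIntegral_univ] at hk
  exact hk.not_gt hfpos

theorem exists_pos_mul_norm_le_integral_abs_inner [IsFiniteMeasure Γ]
    (hso : SpreadOut d (mixMeasure d ρ Γ)) (hint : Integrable (fun x => ‖x‖) Γ) :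
    ∃ ε > (0 : ℝ), ∀ Λ : Ed d, ε * ‖Λ‖ ≤ ∫ X, |⟪X, Λ⟫| ∂Γ := by
  have hinner : ∀ Λ : Ed d, Integrable (fun X => |⟪X, Λ⟫|) Γ := fun Λ =>
    (hint.mul_const ‖Λ‖).mono' (by fun_prop) (ae_of_all _ fun X => by
      simpa using abs_real_inner_le_norm X Λ)
  set F : Ed d → ℝ := fun Λ => ∫ X, |⟪X, Λ⟫| ∂Γ with hF
  have hFlip : ∀ u v, F u ≤ F v + (∫ X, ‖X‖ ∂Γ) * dist u v := by
    intro u v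
    rw [hF, ← integral_mul_const, ← integral_add (hinner v) (hint.mul_const _)]
    refine integral_mono (hinner u) ((hinner v).add (hint.mul_const _)) fun X => ?_
    have h1 : ⟪X, u⟫ = ⟪X, v⟫ + ⟪X, u - v⟫ := by rw [← inner_add_right, add_sub_cancel]
    have h2 := abs_real_inner_le_norm X (u - v)
    have h3 := abs_add_le ⟪X, v⟫ ⟪X, u - v⟫
    simp only [dist_eq_norm]
    rw [h1]
    linarith
  have hFcont : Continuous F :=
    (LipschitzWith.of_le_add_mul (Real.toNNReal (∫ X, ‖X‖ ∂Γ)) fun u v => by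
      rw [Real.coe_toNNReal _ (integral_nonneg fun _ => norm_nonneg _)]
      exact hFlip u v).continuous
  have hFpos : ∀ u : Ed d, u ≠ 0 → 0 < F u := by
    intro u hu
    refine lt_of_le_of_ne (integral_nonneg fun _ => abs_nonneg _) fun h0 => ?_
    have hae := (integral_eq_zero_iff_of_nonneg (fun _ => abs_nonneg _) (hinner u)).1 h0.symm
    refine hso.not_ae_mem (S := (Submodule.span ℝ {u})ᗮ) (fun htop => hu ?_)
      (hae.mono fun X hX => ?_)
    · have : u ∈ (Submodule.span ℝ {u})ᗮ := htop ▸ Submodule.mem_top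
      rw [Submodule.mem_orthogonal_singleton_iff_inner_right] at this
      exact inner_self_eq_zero.1 this
    · rw [Submodule.mem_orthogonal_singleton_iff_inner_left]
      exact abs_eq_zero.1 hX
  have hscale : ∀ Λ : Ed d, Λ ≠ 0 → F Λ = ‖Λ‖ * F (‖Λ‖⁻¹ • Λ) := by
    intro Λ hΛ
    have : ‖Λ‖ ≠ 0 := norm_ne_zero_iff.2 hΛ
    rw [hF, ← integral_const_mul]
    refine integral_congr_ae (ae_of_all _ fun X => ?_)
    simp only [real_inner_smul_right, abs_mul, abs_inv, abs_norm]
    field_simp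
  have hmem : ∀ Λ : Ed d, Λ ≠ 0 → ‖Λ‖⁻¹ • Λ ∈ Metric.sphere (0 : Ed d) 1 := fun Λ hΛ => by
    simpa using norm_smul_inv_norm (𝕜 := ℝ) hΛ
  rcases (Metric.sphere (0 : Ed d) 1).eq_empty_or_nonempty with hemp | hne
  · refine ⟨1, one_pos, fun Λ => ?_⟩
    rcases eq_or_ne Λ 0 with rfl | hΛ
    · simp
    · exact absurd (hmem Λ hΛ) (by simp [hemp])
  · obtain ⟨u, hu, hmin⟩ := (isCompact_sphere (0 : Ed d) 1).exists_isMinOn hne hFcont.continuousOn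
    have hu0 : u ≠ 0 := by
      rintro rfl
      simp at hu
    refine ⟨F u, hFpos u hu0, fun Λ => ?_⟩
    rcases eq_or_ne Λ 0 with rfl | hΛ
    · simp
    · change _ ≤ F Λ
      rw [hscale Λ hΛ, mul_comm]
      exact mul_le_mul_of_nonneg_left (hmin (hmem Λ hΛ)) (norm_nonneg _)

end Drift

/-! ### The minimization procedure -/

section Minimization

variable {d : ℕ} {ρ ρ₁ : ℝ} {Γ : Measure (Ed d)}

theorem measurable_gMin : Measurable (Function.uncurry (gMin d ρ ρ₁)) := by
  have h : Measurable fun p : Ed d × Ed d =>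
      2 * ⟪p.2, p.1⟫ + (1 - 2 * ρ) * ‖p.2‖ ^ 2 := by fun_prop
  exact Measurable.ite (measurableSet_lt h measurable_const) measurable_const
    (Measurable.ite (measurableSet_lt measurable_const h) measurable_const measurable_const)

theorem gMin_mem_Icc (hρ₁ : max ρ (1 - ρ) < ρ₁) (Λ X : Ed d) :
    gMin d ρ ρ₁ Λ X ∈ Icc (1 - ρ₁) ρ₁ := by
  obtain ⟨h1, h2⟩ := max_lt_iff.1 hρ₁
  unfold gMin
  split_ifs <;> constructor <;> linarith

/-- The expected squared norm after one step, conditionally on the covariate. -/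
theorem gMin_drift (hρ : ρ ∈ Ioo (0 : ℝ) 1) (hρ₁ : ρ₁ ≤ 1) {δ : ℝ} (hδ : 0 ≤ δ)
    (h1 : δ ≤ ρ₁ - ρ) (h2 : δ ≤ ρ - (1 - ρ₁)) (Λ X : Ed d) :
    gMin d ρ ρ₁ Λ X * ‖Λ + (1 - ρ) • X‖ ^ 2 + (1 - gMin d ρ ρ₁ Λ X) * ‖Λ - ρ • X‖ ^ 2 +
      2 * δ * |⟪X, Λ⟫| ≤ ‖Λ‖ ^ 2 + 2 * ‖X‖ ^ 2 := by
  obtain ⟨hρ0, hρ1⟩ := hρ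
  have e1 : ‖Λ + (1 - ρ) • X‖ ^ 2 = ‖Λ‖ ^ 2 + 2 * (1 - ρ) * ⟪X, Λ⟫ + (1 - ρ) ^ 2 * ‖X‖ ^ 2 := by
    rw [norm_add_sq_real, real_inner_smul_right, norm_smul, real_inner_comm, mul_pow,
      Real.norm_eq_abs, sq_abs]
    ring
  have e2 : ‖Λ - ρ • X‖ ^ 2 = ‖Λ‖ ^ 2 - 2 * ρ * ⟪X, Λ⟫ + ρ ^ 2 * ‖X‖ ^ 2 := by
    rw [norm_sub_sq_real, real_inner_smul_right, norm_smul, real_inner_comm, mul_pow,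
      Real.norm_eq_abs, sq_abs]
    ring
  set s := ⟪X, Λ⟫ with hs
  set D := 2 * s + (1 - 2 * ρ) * ‖X‖ ^ 2 with hD
  set q := gMin d ρ ρ₁ Λ X with hq
  have hqD : (q - ρ) * D ≤ -(δ * |D|) := by
    rw [hq, gMin, ← hs, ← hD]
    split_ifs with hneg hpos
    · rw [abs_of_neg hneg]
      nlinarith
    · rw [abs_of_pos hpos]
      nlinarith
    · rw [le_antisymm (not_lt.1 hpos) (not_lt.1 hneg)]
      simp
  have hX := sq_nonneg ‖X‖
  have habs : 2 * |s| ≤ |D| + ‖X‖ ^ 2 := by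
    have h3 : 2 * s = D - (1 - 2 * ρ) * ‖X‖ ^ 2 := by rw [hD]; ring
    have h4 : |(1 - 2 * ρ) * ‖X‖ ^ 2| ≤ ‖X‖ ^ 2 := by
      rw [abs_mul, abs_of_nonneg hX]
      exact mul_le_of_le_one_left hX (abs_le.2 ⟨by linarith, by linarith⟩)
    calc 2 * |s| = |2 * s| := by rw [abs_mul, abs_two]
      _ ≤ |D| + |(1 - 2 * ρ) * ‖X‖ ^ 2| := by rw [h3]; exact abs_sub _ _
      _ ≤ _ := by linarith
  have hδ1 : δ ≤ 1 := by linarith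
  have hid : q * ‖Λ + (1 - ρ) • X‖ ^ 2 + (1 - q) * ‖Λ - ρ • X‖ ^ 2 =
      ‖Λ‖ ^ 2 + (q - ρ) * D + ρ * (1 - ρ) * ‖X‖ ^ 2 := by
    rw [e1, e2, hD]
    ring
  rw [hid]
  nlinarith [mul_le_mul_of_nonneg_left habs hδ, mul_le_mul_of_nonneg_right hδ1 hX,
    mul_nonneg hρ0.le hX, mul_nonneg (mul_nonneg hρ0.le hρ0.le) hX,
    mul_le_mul_of_nonneg_right hρ1.le hX]

theorem exists_cesaroLaw_gMin_norm_gt_le [IsProbabilityMeasure Γ] (hρ : ρ ∈ Ioo (0 : ℝ) 1)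
    (hρ₁ : max ρ (1 - ρ) < ρ₁ ∧ ρ₁ < 1) (hsub : SubExp d Γ)
    (hso : SpreadOut d (mixMeasure d ρ Γ)) (Λ : Ed d) {η : ℝ≥0∞} (hη : η ≠ 0) :
    ∃ M : ℝ, ∀ n, cesaroLaw d ρ Γ (gMin d ρ ρ₁) Λ n {x | M < ‖x‖} ≤ η := by
  obtain ⟨h1, h2⟩ := max_lt_iff.1 hρ₁.1
  obtain ⟨hint1, hint2⟩ := integrable_norm_pow_of_subExp hsub
  obtain ⟨ε, hε, hεle⟩ := exists_pos_mul_norm_le_integral_abs_inner hso hint1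
  set δ := min (ρ₁ - ρ) (ρ - (1 - ρ₁)) with hδ
  have hδ0 : 0 < δ := lt_min (by linarith) (by linarith)
  have hg : Measurable (Function.uncurry (gMin d ρ ρ₁)) := measurable_gMin
  have hg01 : ∀ Λ X, gMin d ρ ρ₁ Λ X ∈ Icc (0 : ℝ) 1 := fun Λ X =>
    Icc_subset_Icc (by linarith) hρ₁.2.le (gMin_mem_Icc hρ₁.1 Λ X)
  have hV : Measurable fun x : Ed d => ENNReal.ofReal (‖x‖ ^ 2) := by fun_prop
  have hKint : Integrable (fun X : Ed d => 2 * ‖X‖ ^ 2) Γ := hint2.const_mul 2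
  refine exists_cesaroLaw_norm_gt_le hg hg01 hV (fun _ => ENNReal.ofReal_ne_top)
    (mul_pos (mul_pos two_pos hδ0) hε) (K := ENNReal.ofReal (∫ X, 2 * ‖X‖ ^ 2 ∂Γ))
    ENNReal.ofReal_ne_top (fun x => ?_) Λ hη
  have hinner : Integrable (fun X => 2 * δ * |⟪X, x⟫|) Γ :=
    ((hint1.mul_const ‖x‖).mono' (by fun_prop) (ae_of_all _ fun X => by
      simpa using abs_real_inner_le_norm X x)).const_mul _
  calc ∫⁻ y, ENNReal.ofReal (‖y‖ ^ 2) ∂stepMeasure d ρ Γ (gMin d ρ ρ₁) x +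
        ENNReal.ofReal (2 * δ * ε * ‖x‖)
      ≤ ∫⁻ X, (ENNReal.ofReal (gMin d ρ ρ₁ x X) * ENNReal.ofReal (‖x + (1 - ρ) • X‖ ^ 2) +
          ENNReal.ofReal (1 - gMin d ρ ρ₁ x X) * ENNReal.ofReal (‖x - ρ • X‖ ^ 2)) ∂Γ +
        ∫⁻ X, ENNReal.ofReal (2 * δ * |⟪X, x⟫|) ∂Γ := by
        rw [lintegral_stepMeasure hg hV]
        refine add_le_add le_rfl ?_
        rw [← ofReal_integral_eq_lintegral_ofReal hinner (ae_of_all _ fun X => by positivity),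
          integral_const_mul, mul_assoc (2 * δ)]
        exact ENNReal.ofReal_le_ofReal (mul_le_mul_of_nonneg_left (hεle x) (by positivity))
    _ ≤ ∫⁻ X, (ENNReal.ofReal (‖x‖ ^ 2) + ENNReal.ofReal (2 * ‖X‖ ^ 2)) ∂Γ := by
        rw [← lintegral_add_right _ (by fun_prop)]
        refine lintegral_mono fun X => ?_
        obtain ⟨hq0, hq1⟩ := hg01 x X
        have hq1' : 0 ≤ 1 - gMin d ρ ρ₁ x X := by linarith
        rw [← ENNReal.ofReal_mul hq0, ← ENNReal.ofReal_mul hq1',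
          ← ENNReal.ofReal_add (by positivity) (by positivity),
          ← ENNReal.ofReal_add (by positivity) (by positivity),
          ← ENNReal.ofReal_add (by positivity) (by positivity)]
        exact ENNReal.ofReal_le_ofReal
          (gMin_drift hρ hρ₁.2.le hδ0.le (min_le_left _ _) (min_le_right _ _) x X)
    _ = ENNReal.ofReal (‖x‖ ^ 2) + ENNReal.ofReal (∫ X, 2 * ‖X‖ ^ 2 ∂Γ) := by
        rw [lintegral_add_left measurable_const, lintegral_const, measure_univ, mul_one,
          ofReal_integral_eq_lintegral_ofReal hKint (ae_of_all _ fun X => by positivity)]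

/-- The covariate term dominates the sign of the imbalance when it is large enough. -/
theorem gMin_of_two_mul_norm_lt {Λ X : Ed d} (h : 2 * ‖Λ‖ < |1 - 2 * ρ| * ‖X‖) :
    gMin d ρ ρ₁ Λ X = if ρ < 1 / 2 then 1 - ρ₁ else ρ₁ := by
  have hX : 0 < ‖X‖ := by
    refine (norm_nonneg X).lt_of_ne fun h0 => ?_
    rw [← h0] at h
    linarith [norm_nonneg Λ]
  have hs := abs_le.1 (abs_real_inner_le_norm X Λ)
  have h2 : 2 * (‖X‖ * ‖Λ‖) < |1 - 2 * ρ| * ‖X‖ ^ 2 := by nlinarith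
  unfold gMin
  by_cases hρ : ρ < 1 / 2
  · rw [abs_of_pos (by linarith)] at h2
    rw [if_pos hρ, if_neg (by linarith), if_pos (by linarith)]
  · rw [abs_of_nonpos (by linarith)] at h2
    rw [if_neg hρ, if_pos (by linarith)]

theorem exists_measureReal_le_norm_lt (m : Measure (Ed d)) [IsFiniteMeasure m] {ε : ℝ}
    (hε : 0 < ε) : ∃ n : ℕ, m.real {x | (n : ℝ) ≤ ‖x‖} < ε := by
  have hs : ∀ n : ℕ, MeasurableSet {x : Ed d | (n : ℝ) ≤ ‖x‖} := fun n =>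
    measurableSet_le measurable_const measurable_norm
  have hdec : DecreasesToZero 1 fun n : ℕ =>
      ({x : Ed d | (n : ℝ) ≤ ‖x‖}).indicator fun _ => (1 : ℝ≥0∞) := by
    refine decreasesToZero_indicator hs (fun i j hij x hx => ?_) ?_
    · exact (Nat.cast_le.2 hij).trans (show (j : ℝ) ≤ ‖x‖ from hx)
    · refine eq_empty_of_forall_notMem fun x hx => ?_
      obtain ⟨n, hn⟩ := exists_nat_gt ‖x‖
      exact hn.not_ge (mem_iInter.1 hx n)
  have hinf := iInf_lintegral_eq_zero ENNReal.one_ne_top hdec m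
  simp only [lintegral_indicator_const (hs _), one_mul] at hinf
  obtain ⟨n, hn⟩ := iInf_lt_iff.1 (hinf.trans_lt (ENNReal.ofReal_pos.2 hε))
  exact ⟨n, (ENNReal.lt_ofReal_iff_toReal_lt (measure_ne_top _ _)).1 hn⟩

/-- For covariates of large norm, the average allocation deviates from `ρ`. -/
theorem exists_targeted_deviation (hρhalf : ρ ≠ 1 / 2)
    (hρ₁ : max ρ (1 - ρ) < ρ₁ ∧ ρ₁ < 1) (π : Measure (Ed d)) [IsProbabilityMeasure π] :
    ∃ s κ M : ℝ, 0 < κ ∧ ∀ X : Ed d, M ≤ ‖X‖ →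
      κ ≤ s * ((∫ Λ, gMin d ρ ρ₁ Λ X ∂π) - ρ) := by
  obtain ⟨h1, h2⟩ := max_lt_iff.1 hρ₁.1
  have h0 := hρ₁.2
  set q₀ : ℝ := if ρ < 1 / 2 then 1 - ρ₁ else ρ₁ with hq₀
  have hs0 : q₀ - ρ ≠ 0 := by
    rw [hq₀]
    split_ifs
    · exact (by linarith : 1 - ρ₁ - ρ < 0).ne
    · exact (by linarith : 0 < ρ₁ - ρ).ne'
  have hs1 : |q₀ - ρ| ≤ 1 := by
    rw [hq₀, abs_le]
    split_ifs <;> constructor <;> linarith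
  have ha : 0 < |1 - 2 * ρ| := abs_pos.2 fun h => hρhalf (by linarith)
  have hs2 : 0 < (q₀ - ρ) ^ 2 := by positivity
  obtain ⟨n, hn⟩ := exists_measureReal_le_norm_lt π (ε := (q₀ - ρ) ^ 2 / 4) (by positivity)
  set B : Set (Ed d) := {x | (n : ℝ) ≤ ‖x‖} with hB
  have hBm : MeasurableSet B := measurableSet_le measurable_const measurable_norm
  refine ⟨q₀ - ρ, (q₀ - ρ) ^ 2 / 2, 2 * n / |1 - 2 * ρ|, by positivity, fun X hX => ?_⟩
  rw [div_le_iff₀' ha] at hX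
  have hgX : Measurable fun Λ => gMin d ρ ρ₁ Λ X := measurable_gMin.of_uncurry_right
  have hgint : Integrable (fun Λ => gMin d ρ ρ₁ Λ X) π :=
    Integrable.of_bound hgX.aestronglyMeasurable 1 (ae_of_all _ fun Λ => by
      obtain ⟨h3, h4⟩ := gMin_mem_Icc hρ₁.1 Λ X
      exact abs_le.2 ⟨by linarith, by linarith⟩)
  have hpt : ∀ Λ, (q₀ - ρ) ^ 2 - B.indicator (fun _ => (2 : ℝ)) Λ ≤
      (q₀ - ρ) * (gMin d ρ ρ₁ Λ X - ρ) := by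
    intro Λ
    by_cases hΛ : Λ ∈ B
    · obtain ⟨h3, h4⟩ := gMin_mem_Icc hρ₁.1 Λ X
      have h5 : |gMin d ρ ρ₁ Λ X - ρ| ≤ 1 :=
        abs_le.2 ⟨by linarith, by linarith⟩
      have h6 : |(q₀ - ρ) * (gMin d ρ ρ₁ Λ X - ρ)| ≤ 1 := by
        rw [abs_mul]
        exact mul_le_one₀ hs1 (abs_nonneg _) h5
      rw [indicator_of_mem hΛ]
      linarith [neg_le_of_abs_le h6, (sq_le_one_iff_abs_le_one _).2 hs1]
    · have h3 : ‖Λ‖ < n := not_le.1 hΛ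
      rw [indicator_of_notMem hΛ, sub_zero, gMin_of_two_mul_norm_lt (by linarith), sq]
  have hmono : ∫ Λ, ((q₀ - ρ) ^ 2 - B.indicator (fun _ => (2 : ℝ)) Λ) ∂π ≤
      ∫ Λ, (q₀ - ρ) * (gMin d ρ ρ₁ Λ X - ρ) ∂π := integral_mono
    ((integrable_const _).sub ((integrable_const (2 : ℝ)).indicator hBm))
    ((hgint.sub (integrable_const ρ)).const_mul (q₀ - ρ)) hpt
  rw [integral_const_mul, integral_sub hgint (integrable_const ρ),
    integral_sub (integrable_const _) ((integrable_const (2 : ℝ)).indicator hBm),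
    integral_indicator_const _ hBm] at hmono
  simp only [integral_const, probReal_univ, smul_eq_mul, one_mul] at hmono
  linarith

end Minimization

/-- The shift problem for the minimization procedure: when `ρ ≠ 1/2` and the covariate
distribution is unbounded, there is a bounded measurable `f` whose average shift does not
vanish: the actual targeted allocation ratio deviates from `ρ` in an `f`-weighted average,
and the average expected shift converges to the nonzero limit `∫ h dπ`. -/
theorem stmt10 (d : ℕ) (ρ ρ₁ : ℝ) (hρ : ρ ∈ Set.Ioo (0 : ℝ) 1) (hρhalf : ρ ≠ 1 / 2)
    (hρ₁ : max ρ (1 - ρ) < ρ₁ ∧ ρ₁ < 1)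
    (Γ : Measure (Ed d)) [IsProbabilityMeasure Γ]
    (hsub : SubExp d Γ) (hso : SpreadOut d (mixMeasure d ρ Γ))
    (hunb : ∀ M > (0 : ℝ), 0 < Γ {x : Ed d | M < ‖x‖})
    (π : Measure (Ed d)) [IsProbabilityMeasure π]
    (hπinv : IsInvariantMeasure d ρ Γ (gMin d ρ ρ₁) π)
    (hπuniq : ∀ π' : Measure (Ed d), IsProbabilityMeasure π' →
      IsInvariantMeasure d ρ Γ (gMin d ρ ρ₁) π' → π' = π) :
    ∃ f : Ed d → ℝ, Measurable f ∧ (∃ Cb : ℝ, ∀ x, |f x| ≤ Cb) ∧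
      (∫ x, ((∫ Λ, gMin d ρ ρ₁ Λ x ∂π) - ρ) * f x ∂Γ) ≠ 0 ∧
      (∫ Λ, (∫ X, (gMin d ρ ρ₁ Λ X - ρ) * f X ∂Γ) ∂π) ≠ 0 ∧
      ∀ Λ : Ed d, Tendsto
        (fun n : ℕ => (n : ℝ)⁻¹ * ∑ i ∈ Finset.range n,
          (kernelOp d ρ Γ (gMin d ρ ρ₁))^[i]
            (fun Λ' => ∫ X, (gMin d ρ ρ₁ Λ' X - ρ) * f X ∂Γ) Λ)
        atTop
        (nhds (∫ Λ', (∫ X, (gMin d ρ ρ₁ Λ' X - ρ) * f X ∂Γ) ∂π)) := by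
  obtain ⟨s, κ, M, hκ, hdev⟩ := exists_targeted_deviation hρhalf hρ₁ π
  have hg : Measurable (Function.uncurry (gMin d ρ ρ₁)) := measurable_gMin
  have hg' : Measurable fun p : Ed d × Ed d => gMin d ρ ρ₁ p.1 p.2 := hg
  have hIcc := gMin_mem_Icc (d := d) hρ₁.1
  have hgabs : ∀ Λ X : Ed d, |gMin d ρ ρ₁ Λ X - ρ| ≤ 1 := fun Λ X =>
    abs_le.2 ⟨by linarith [(hIcc Λ X).1, hρ.2, hρ₁.2], by linarith [(hIcc Λ X).2, hρ.1, hρ₁.2]⟩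
  have hgint : ∀ X : Ed d, Integrable (fun Λ => gMin d ρ ρ₁ Λ X) π := fun X =>
    Integrable.of_bound hg.of_uncurry_right.aestronglyMeasurable 1 (ae_of_all _ fun Λ =>
      abs_le.2 ⟨by linarith [(hIcc Λ X).1, hρ₁.2], by linarith [(hIcc Λ X).2, hρ₁.2]⟩)
  set S : Set (Ed d) := {x | M ≤ ‖x‖} with hS
  have hSm : MeasurableSet S := measurableSet_le measurable_const measurable_norm
  set f : Ed d → ℝ := S.indicator fun _ => 1 with hf
  have hfm : Measurable f := measurable_const.indicator hSm
  have hf1 : ∀ x, |f x| ≤ 1 := fun x => by by_cases hx : x ∈ S <;> simp [hf, hx]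
  have hgf : ∀ Λ X : Ed d, |(gMin d ρ ρ₁ Λ X - ρ) * f X| ≤ 1 := fun Λ X => by
    rw [abs_mul]
    exact mul_le_one₀ (hgabs Λ X) (abs_nonneg _) (hf1 X)
  have hprod : Measurable fun p : Ed d × Ed d => (gMin d ρ ρ₁ p.1 p.2 - ρ) * f p.2 := by fun_prop
  have hswap : ∫ Λ, (∫ X, (gMin d ρ ρ₁ Λ X - ρ) * f X ∂Γ) ∂π =
      ∫ x, ((∫ Λ, gMin d ρ ρ₁ Λ x ∂π) - ρ) * f x ∂Γ := by
    rw [integral_integral_swap (Integrable.of_bound hprod.aestronglyMeasurable 1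
      (ae_of_all _ fun p => hgf p.1 p.2))]
    refine integral_congr_ae (ae_of_all _ fun X => ?_)
    simp only
    rw [integral_mul_const, integral_sub (hgint X) (integrable_const ρ)]
    simp
  have hhm : Measurable fun Λ => ∫ X, (gMin d ρ ρ₁ Λ X - ρ) * f X ∂Γ :=
    hprod.stronglyMeasurable.integral_prod_right.measurable
  have hh1 : ∀ Λ, |∫ X, (gMin d ρ ρ₁ Λ X - ρ) * f X ∂Γ| ≤ 1 := fun Λ => by
    simpa using norm_integral_le_of_norm_le_const (μ := Γ)
      (f := fun X => (gMin d ρ ρ₁ Λ X - ρ) * f X) (ae_of_all _ (hgf Λ))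
  have hne : ∫ x, ((∫ Λ, gMin d ρ ρ₁ Λ x ∂π) - ρ) * f x ∂Γ ≠ 0 := by
    intro h0
    have hΓS : 0 < Γ.real S :=
      ENNReal.toReal_pos ((hunb (max M 1) (by positivity)).trans_le (measure_mono fun x hx =>
        (le_max_left M 1).trans (le_of_lt (show max M 1 < ‖x‖ from hx)))).ne' (measure_ne_top _ _)
    have hHm : Measurable fun x => ∫ Λ, gMin d ρ ρ₁ Λ x ∂π :=
      hg.stronglyMeasurable.integral_prod_left.measurable
    have hHint : Integrable (fun x => s * (((∫ Λ, gMin d ρ ρ₁ Λ x ∂π) - ρ) * f x)) Γ := by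
      refine (Integrable.of_bound (by fun_prop) 1 (ae_of_all _ fun X => ?_)).const_mul s
      have := norm_integral_le_of_norm_le_const (μ := π)
        (f := fun Λ => gMin d ρ ρ₁ Λ X - ρ) (ae_of_all _ fun Λ => hgabs Λ X)
      rw [integral_sub (hgint X) (integrable_const ρ)] at this
      rw [norm_mul]
      exact mul_le_one₀ (by simpa using this) (norm_nonneg _) (hf1 X)
    have hmono := integral_mono (μ := Γ) ((integrable_const κ).indicator hSm) hHint fun X => by
      by_cases hX : X ∈ S
      · simpa [hf, hX] using hdev X hX
      · simp [hf, hX]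
    rw [integral_const_mul, h0, mul_zero, integral_indicator_const _ hSm, smul_eq_mul] at hmono
    exact (mul_pos hΓS hκ).not_ge hmono
  refine ⟨f, hfm, ⟨1, hf1⟩, hne, hswap ▸ hne, fun Λ => ?_⟩
  exact tendsto_average_iterate_kernelOp ⟨hρ.1.le, hρ.2.le⟩ hg (sub_pos.2 hρ₁.2)
    (fun Λ X => ⟨(hIcc Λ X).1, by linarith [(hIcc Λ X).2]⟩) hso Λ
    (fun η hη => exists_cesaroLaw_gMin_norm_gt_le hρ hρ₁ hsub hso Λ hη) hπuniq hhm hh1
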